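/- arXiv:1104.4008 — 3 statements merged into one kernel-verified Lean document; each statement's English description precedes it below -/
import Mathlib

section
/- Fix Q ∈ (0,1), N ∈ ℤ_{≥0} and δ > 0. Then there exists δ'' > 0 such that for all ε ∈ (0,δ'') and all n ∈ ℤ_{≥0} for which ν := −log Q − nε satisfies |ν| < δ'', one has (with q = e^{−ε}): |∑_{s=1}^∞ log(1 − q^{n+s}) + ∑_{r,s ≥ 0, r+s ≤ N} (Li_{2−r−s}(Q)·B_r/(r!·s!))·ν^s·ε^{r−1}| ≤ δ·max(ε,|ν|)^N/ε. In other words, log((q)_∞/(q)_n) has the asymptotic expansion −∑_{r,s≥0} (Li_{2−r−s}(Q) B_r/(r! s!)) ν^s ε^{r−1} as ε,ν → 0. -/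
/-- The polylogarithm `Li_m(x) = ∑_{k ≥ 1} x^k / k^m`, for `m : ℤ`. -/
noncomputable def polylog (m : ℤ) (x : ℝ) : ℝ :=
  ∑' k : ℕ, x ^ (k + 1) / ((k : ℝ) + 1) ^ m

open Finset

noncomputable def bcoef (r : ℕ) : ℝ := (bernoulli r : ℝ) / (r.factorial : ℝ)

lemma exp_rem (x : ℝ) (n : ℕ) :
    |Real.exp x - ∑ m ∈ range n, x ^ m / (m.factorial : ℝ)| ≤ |x| ^ n * Real.exp |x| := by
  have h := Complex.norm_exp_sub_sum_le_norm_mul_exp (x : ℂ) n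
  have e : Complex.exp x - ∑ m ∈ range n, (x:ℂ) ^ m / (m.factorial : ℂ)
      = ((Real.exp x - ∑ m ∈ range n, x ^ m / (m.factorial : ℝ) : ℝ) : ℂ) := by
    push_cast; rfl
  rw [e, Complex.norm_real, Complex.norm_real] at h
  simpa using h

lemma bern_poly (m : ℕ) : ∃ D : Polynomial ℝ, ∀ t : ℝ,
    (∑ r ∈ range m, bcoef r * t ^ r) * (∑ j ∈ range (m + 1), t ^ j / (j.factorial : ℝ) - 1)
      = t + t ^ (m + 1) * D.eval t - (if m = 0 then t else 0) := by
  rcases Nat.eq_zero_or_pos m with rfl | hm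
  · exact ⟨0, fun t => by simp⟩
  set P : Polynomial ℝ := ∑ r ∈ range m, Polynomial.C (bcoef r) * Polynomial.X ^ r with hP
  set T : Polynomial ℝ := ∑ j ∈ range (m + 1), Polynomial.C (1 / (j.factorial : ℝ)) * Polynomial.X ^ j - 1 with hT
  have hPc : ∀ i < m, P.coeff i = (PowerSeries.coeff i) (bernoulliPowerSeries ℝ) := by
    intro i hi
    simp [hP, Polynomial.finsetSum_coeff, Polynomial.coeff_X_pow, hi, bernoulliPowerSeries, bcoef]
  have hTc : ∀ i < m + 1, T.coeff i = (PowerSeries.coeff i) (PowerSeries.exp ℝ - 1) := by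
    intro i hi
    simp [hT, Polynomial.finsetSum_coeff, Polynomial.coeff_X_pow, PowerSeries.coeff_exp,
      Polynomial.coeff_one, PowerSeries.coeff_one, -one_div, hi]
  have hdvd : Polynomial.X ^ (m + 1) ∣ P * T - Polynomial.X := by
    rw [Polynomial.X_pow_dvd_iff]
    intro d hd
    have h1 : (P * T).coeff d = PowerSeries.coeff d (PowerSeries.X : PowerSeries ℝ) := by
      rw [← bernoulliPowerSeries_mul_exp_sub_one ℝ, Polynomial.coeff_mul, PowerSeries.coeff_mul]
      refine sum_congr rfl ?_
      rintro ⟨i, j⟩ hij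
      rw [Finset.HasAntidiagonal.mem_antidiagonal] at hij
      simp only at hij ⊢
      have hj := hTc j (by omega)
      rw [hj]
      by_cases hi : i < m
      · rw [hPc i hi]
      · have : j = 0 := by omega
        subst this
        simp
    rw [Polynomial.coeff_sub, h1, PowerSeries.coeff_X, Polynomial.coeff_X]
    simp [eq_comm]
  obtain ⟨D, hD⟩ := hdvd
  refine ⟨D, fun t => ?_⟩
  have h2 := congrArg (Polynomial.eval t) hD
  simp only [hP, hT, Polynomial.eval_sub, Polynomial.eval_mul, Polynomial.eval_finsetSum,
    Polynomial.eval_C, Polynomial.eval_pow, Polynomial.eval_X, Polynomial.eval_one] at h2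
  have h3 : ∑ j ∈ range (m + 1), t ^ j / (j.factorial : ℝ)
      = ∑ j ∈ range (m + 1), 1 / (j.factorial : ℝ) * t ^ j :=
    sum_congr rfl fun j _ => by ring
  rw [h3, if_neg (by omega)]
  linarith

lemma bern_small (m : ℕ) (hm : 0 < m) : ∃ C : ℝ, 0 ≤ C ∧ ∀ t : ℝ, 0 < t → t ≤ 1 →
    |t / (Real.exp t - 1) - ∑ r ∈ range m, bcoef r * t ^ r| ≤ C * t ^ m := by
  obtain ⟨D, hD⟩ := bern_poly m
  obtain ⟨C1, hC1⟩ := (isCompact_Icc (a := (0:ℝ)) (b := 1)).exists_bound_of_continuousOn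
    (f := fun t => D.eval t) D.continuous.continuousOn
  obtain ⟨C2, hC2⟩ := (isCompact_Icc (a := (0:ℝ)) (b := 1)).exists_bound_of_continuousOn
    (f := fun t => (∑ r ∈ range m, bcoef r * t ^ r) * Real.exp t) (by fun_prop)
  have n1 : 0 ≤ C1 := (norm_nonneg _).trans (hC1 0 (by simp))
  have n2 : 0 ≤ C2 := (norm_nonneg _).trans (hC2 0 (by simp))
  refine ⟨C1 + C2, by positivity, fun t ht ht1 => ?_⟩
  have b1 := hC1 t ⟨ht.le, ht1⟩
  have b2 := hC2 t ⟨ht.le, ht1⟩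
  have hR := exp_rem t (m + 1)
  have hd := hD t
  rw [if_neg (by omega)] at hd
  simp only [Real.norm_eq_abs] at b1 b2
  set P := ∑ r ∈ range m, bcoef r * t ^ r
  set T := ∑ j ∈ range (m + 1), t ^ j / (j.factorial : ℝ)
  have he : t ≤ Real.exp t - 1 := by linarith [Real.add_one_le_exp t]
  have hpos : 0 < Real.exp t - 1 := by linarith
  have e1 : t / (Real.exp t - 1) - P = (-(t ^ (m+1) * D.eval t) - P * (Real.exp t - T)) / (Real.exp t - 1) := by
    field_simp
    linarith
  rw [e1, abs_div, abs_of_pos hpos, div_le_iff₀ hpos]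
  rw [abs_of_pos ht] at hR
  have hp : 0 < t ^ (m+1) := by positivity
  have b3 : |P * (Real.exp t - T)| ≤ C2 * t ^ (m+1) := by
    rw [abs_mul]
    rw [abs_mul, abs_of_pos (Real.exp_pos t)] at b2
    calc |P| * |Real.exp t - T| ≤ |P| * (t ^ (m+1) * Real.exp t) := by gcongr
      _ = (|P| * Real.exp t) * t ^ (m+1) := by ring
      _ ≤ _ := by gcongr
  have b4 : |t ^ (m+1) * D.eval t| ≤ C1 * t ^ (m+1) := by
    rw [abs_mul, abs_of_pos hp, mul_comm]; gcongr
  calc _ ≤ |-(t ^ (m+1) * D.eval t)| + |P * (Real.exp t - T)| := abs_sub _ _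
    _ ≤ C1 * t ^ (m+1) + C2 * t ^ (m+1) := by rw [abs_neg]; gcongr
    _ = (C1 + C2) * t ^ m * t := by ring
    _ ≤ _ := by gcongr

lemma bern_bound (m : ℕ) (hm : 0 < m) : ∃ C : ℝ, 0 ≤ C ∧ ∀ t : ℝ, 0 < t →
    |t / (Real.exp t - 1) - ∑ r ∈ range m, bcoef r * t ^ r| ≤ C * t ^ m := by
  obtain ⟨C, hC, h⟩ := bern_small m hm
  have hS : 0 ≤ ∑ r ∈ range m, |bcoef r| := sum_nonneg fun _ _ => abs_nonneg _
  refine ⟨C + (1 + ∑ r ∈ range m, |bcoef r|), by positivity, fun t ht => ?_⟩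
  have hp : 0 < t ^ m := by positivity
  rcases le_total t 1 with h1 | h1
  · refine (h t ht h1).trans ?_
    gcongr
    linarith
  · have he : t ≤ Real.exp t - 1 := by linarith [Real.add_one_le_exp t]
    have hpos : 0 < Real.exp t - 1 := by linarith
    have a1 : |t / (Real.exp t - 1)| ≤ t ^ m := by
      rw [abs_of_pos (by positivity)]
      exact ((div_le_one hpos).2 he).trans (one_le_pow₀ h1)
    have a2 : |∑ r ∈ range m, bcoef r * t ^ r| ≤ (∑ r ∈ range m, |bcoef r|) * t ^ m := by
      refine (abs_sum_le_sum_abs _ _).trans ?_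
      rw [sum_mul]
      refine sum_le_sum fun r hr => ?_
      rw [abs_mul, abs_of_pos (pow_pos ht r)]
      gcongr
      exact (mem_range.1 hr).le
    have := abs_sub (t / (Real.exp t - 1)) (∑ r ∈ range m, bcoef r * t ^ r)
    nlinarith [mul_nonneg hC hp.le]

lemma biv_bound (N : ℕ) : ∃ C : ℝ, 0 ≤ C ∧ ∀ x y m : ℝ, 0 < x → x ≤ m → |y| ≤ m →
    |x / (Real.exp x - 1) * Real.exp y - ∑ r ∈ range (N + 1), ∑ s ∈ range (N + 1 - r),
      bcoef r * x ^ r * (y ^ s / (s.factorial : ℝ))| ≤ C * m ^ (N + 1) * Real.exp |y| := by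
  obtain ⟨C, hC, h⟩ := bern_bound (N + 1) (by omega)
  have hS : 0 ≤ ∑ r ∈ range (N + 1), |bcoef r| := sum_nonneg fun _ _ => abs_nonneg _
  refine ⟨C + ∑ r ∈ range (N + 1), |bcoef r|, by positivity, fun x y m hx hxm hym => ?_⟩
  have hm : 0 < m := by linarith
  have e : x / (Real.exp x - 1) * Real.exp y - ∑ r ∈ range (N + 1), ∑ s ∈ range (N + 1 - r),
      bcoef r * x ^ r * (y ^ s / (s.factorial : ℝ))
      = (x / (Real.exp x - 1) - ∑ r ∈ range (N + 1), bcoef r * x ^ r) * Real.exp y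
       + ∑ r ∈ range (N + 1), bcoef r * x ^ r *
          (Real.exp y - ∑ s ∈ range (N + 1 - r), y ^ s / (s.factorial : ℝ)) := by
    simp only [mul_sub, sum_sub_distrib, sub_mul, ← mul_sum, sum_mul]
    ring
  rw [e, add_mul, add_mul]
  refine (abs_add_le _ _).trans (add_le_add ?_ ?_)
  · rw [abs_mul, abs_of_pos (Real.exp_pos y)]
    refine mul_le_mul ((h x hx).trans ?_) (Real.exp_le_exp.2 (le_abs_self y)) (Real.exp_pos y).le (by positivity)
    gcongr
  · refine (abs_sum_le_sum_abs _ _).trans ?_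
    rw [sum_mul, sum_mul]
    refine sum_le_sum fun r hr => ?_
    rw [mem_range] at hr
    rw [abs_mul, abs_mul, abs_of_pos (pow_pos hx r)]
    calc |bcoef r| * x ^ r * _ ≤ |bcoef r| * m ^ r * (m ^ (N + 1 - r) * Real.exp |y|) := by
          gcongr
          refine (exp_rem y _).trans ?_
          gcongr
      _ = |bcoef r| * (m ^ r * m ^ (N + 1 - r)) * Real.exp |y| := by ring
      _ = _ := by rw [← pow_add, Nat.add_sub_cancel' hr.le]

lemma summable_pow_succ (N : ℕ) (x : ℝ) (h0 : 0 ≤ x) (h1 : x < 1) :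
    Summable fun k : ℕ => ((k : ℝ) + 1) ^ N * x ^ (k + 1) := by
  have := summable_pow_mul_geometric_of_norm_lt_one (R := ℝ) N (r := x) (by rwa [Real.norm_of_nonneg h0])
  have := (summable_nat_add_iff 1).2 this
  simpa using this

lemma polylog_hasSum (m : ℤ) (x : ℝ) (h0 : 0 ≤ x) (h1 : x < 1) :
    HasSum (fun k : ℕ => x ^ (k + 1) / ((k : ℝ) + 1) ^ m) (polylog m x) := by
  refine Summable.hasSum ?_
  refine Summable.of_nonneg_of_le (fun k => by positivity) (fun k => ?_)
    (summable_pow_succ m.natAbs x h0 h1)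
  rw [div_eq_mul_inv, ← zpow_neg, mul_comm, ← zpow_natCast _ m.natAbs]
  refine mul_le_mul_of_nonneg_right (zpow_le_zpow_right₀ ?_ ?_) (by positivity)
  · linarith [(Nat.cast_nonneg k : (0:ℝ) ≤ k)]
  · omega

lemma log_hasSum (ε : ℝ) (hε : 0 < ε) (n : ℕ) :
    HasSum (fun k : ℕ => -(Real.exp (-(n * ε)) ^ (k + 1) / ((k : ℝ) + 1)
        / (Real.exp ((k + 1) * ε) - 1)))
      (∑' s : ℕ, Real.log (1 - Real.exp (-ε) ^ (n + s + 1))) := by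
  set p := Real.exp (-ε) with hp
  have p0 : 0 < p := Real.exp_pos _
  have p1 : p < 1 := by rw [hp, Real.exp_lt_one_iff]; linarith
  set f : ℕ → ℕ → ℝ := fun s k => (p ^ (n + s + 1)) ^ (k + 1) / ((k : ℝ) + 1) with hf
  have hs : Summable (Function.uncurry f) := by
    have hg := summable_geometric_of_lt_one p0.le p1
    refine Summable.of_nonneg_of_le (fun ⟨s, k⟩ => ?_) (fun ⟨s, k⟩ => ?_)
      (hg.mul_of_nonneg hg (fun _ => by positivity) (fun _ => by positivity))
    · simp only [Function.uncurry, hf]; positivity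
    · simp only [Function.uncurry, hf]
      refine (div_le_self (by positivity) (by linarith [(Nat.cast_nonneg k : (0:ℝ) ≤ k)])).trans ?_
      rw [← pow_mul, ← pow_add]
      exact pow_le_pow_of_le_one p0.le p1.le (by nlinarith [Nat.zero_le (n*k), Nat.zero_le (s*k)])
  have h1 : ∀ s, HasSum (f s) (-Real.log (1 - p ^ (n + s + 1))) := fun s => by
    refine Real.hasSum_pow_div_log_of_abs_lt_one ?_
    rw [abs_of_pos (by positivity)]
    exact pow_lt_one₀ p0.le p1 (by omega)
  have h2 : ∀ k : ℕ, HasSum (fun s => f s k) (Real.exp (-(n * ε)) ^ (k + 1) / ((k : ℝ) + 1)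
        / (Real.exp ((k + 1) * ε) - 1)) := fun k => by
    have q1 : p ^ (k + 1) < 1 := pow_lt_one₀ p0.le p1 (by omega)
    have hg := (hasSum_geometric_of_lt_one (pow_nonneg p0.le (k+1)) q1).mul_left
      (p ^ (k + 1) * (p ^ n) ^ (k + 1) / ((k : ℝ) + 1))
    have E1 : (fun s => f s k) =
        fun i => p ^ (k + 1) * (p ^ n) ^ (k + 1) / ((k : ℝ) + 1) * (p ^ (k + 1)) ^ i := by
      funext s
      simp only [hf]
      rw [← pow_mul, ← pow_mul, ← pow_mul, div_mul_eq_mul_div, ← pow_add, ← pow_add]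
      congr 2; ring
    have E2 : Real.exp (-(n * ε)) ^ (k + 1) / ((k : ℝ) + 1) / (Real.exp ((k + 1) * ε) - 1)
        = p ^ (k + 1) * (p ^ n) ^ (k + 1) / ((k : ℝ) + 1) * (1 - p ^ (k + 1))⁻¹ := by
      have e1 : Real.exp (-(n * ε)) = p ^ n := by rw [hp, ← Real.exp_nat_mul]; congr 1; ring
      have e2 : Real.exp ((k + 1) * ε) = (p ^ (k + 1))⁻¹ := by
        rw [hp, ← Real.exp_nat_mul, ← Real.exp_neg]; congr 1; push_cast; ring
      rw [e1, e2]
      have h5 : 0 < p ^ (k + 1) := by positivity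
      have h6 : 1 - p ^ (k + 1) ≠ 0 := by linarith
      have h4 : (p ^ (k + 1))⁻¹ - 1 = (1 - p ^ (k + 1)) / p ^ (k + 1) := by field_simp
      rw [h4]
      field_simp
    rw [E1, E2]
    exact hg
  have hS := hs.hasSum
  have A := hS.prod_fiberwise h1
  have B := ((Equiv.prodComm ℕ ℕ).hasSum_iff.2 hS).prod_fiberwise h2
  have A' := A.neg
  simp only [neg_neg] at A'
  rw [A'.tsum_eq]
  exact B.neg

lemma term_identity (Q : ℝ) (hQ : 0 < Q) (N : ℕ) (ε ν K : ℝ) (k n : ℕ) (hε : 0 < ε)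
    (hK : K = (k : ℝ) + 1) (hν : ν = -Real.log Q - n * ε) :
    -(Real.exp (-(n * ε)) ^ (k + 1) / K / (Real.exp (K * ε) - 1)) +
      ∑ r ∈ range (N + 1), ∑ s ∈ range (N + 1 - r),
        Q ^ (k + 1) / K ^ (2 - (r : ℤ) - (s : ℤ)) * ((bernoulli r : ℝ) /
          ((r.factorial : ℝ) * (s.factorial : ℝ)) * ν ^ s * ε ^ ((r : ℤ) - 1))
    = -(Q ^ (k + 1) / (K ^ 2 * ε)) * (K * ε / (Real.exp (K * ε) - 1) * Real.exp (K * ν)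
        - ∑ r ∈ range (N + 1), ∑ s ∈ range (N + 1 - r),
            bcoef r * (K * ε) ^ r * ((K * ν) ^ s / (s.factorial : ℝ))) := by
  have K0 : 0 < K := by rw [hK]; positivity
  have hden : 0 < Real.exp (K * ε) - 1 := by
    have := Real.add_one_le_exp (K * ε)
    have : 0 < K * ε := by positivity
    linarith
  rw [mul_sub, sub_eq_add_neg]
  congr 1
  · have : Real.exp (-(n * ε)) ^ (k + 1) = Q ^ (k + 1) * Real.exp (K * ν) := by
      have : -(n * ε) = Real.log Q + ν := by rw [hν]; ring
      rw [this, Real.exp_add, Real.exp_log hQ, mul_pow, ← Real.exp_nat_mul, hK]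
      push_cast
      rfl
    rw [this]
    field_simp
  · rw [neg_mul, neg_neg, mul_sum]
    refine sum_congr rfl fun r _ => ?_
    rw [mul_sum]
    refine sum_congr rfl fun s _ => ?_
    rw [zpow_sub₀ K0.ne', zpow_sub₀ K0.ne', zpow_sub₀ hε.ne', bcoef]
    simp only [zpow_natCast, zpow_ofNat]
    rw [mul_pow, mul_pow]
    field_simp

theorem log_qpoch_ratio_asymptotic_expansion
    (Q : ℝ) (hQ : Q ∈ Set.Ioo (0 : ℝ) 1) (N : ℕ) (δ : ℝ) (hδ : 0 < δ) :
    ∃ δ'' > (0 : ℝ), ∀ ε : ℝ, ε ∈ Set.Ioo 0 δ'' → ∀ n : ℕ,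
      |(-Real.log Q - n * ε)| < δ'' →
      |(∑' s : ℕ, Real.log (1 - Real.exp (-ε) ^ (n + s + 1))) +
          ∑ r ∈ Finset.range (N + 1), ∑ s ∈ Finset.range (N + 1 - r),
            polylog (2 - (r : ℤ) - (s : ℤ)) Q * (bernoulli r : ℝ) /
                ((r.factorial : ℝ) * (s.factorial : ℝ)) *
              (-Real.log Q - n * ε) ^ s * ε ^ ((r : ℤ) - 1)|
        ≤ δ * max ε |(-Real.log Q - n * ε)| ^ N / ε := by
  obtain ⟨Q0, Q1⟩ := hQ
  have hlog : Real.log Q < 0 := Real.log_neg Q0 Q1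
  obtain ⟨C, hC, hb⟩ := biv_bound N
  set x := Real.exp (Real.log Q / 2) with hx
  have x0 : 0 < x := Real.exp_pos _
  have x1 : x < 1 := by rw [hx, Real.exp_lt_one_iff]; linarith
  have hsum := summable_pow_succ (N + 1) x x0.le x1
  set S := ∑' k : ℕ, ((k : ℝ) + 1) ^ (N + 1) * x ^ (k + 1) with hS
  have S0 : 0 ≤ S := tsum_nonneg fun k => by positivity
  have CS : 0 ≤ C * S := mul_nonneg hC S0
  refine ⟨min (-Real.log Q / 2) (δ / (C * S + 1)), lt_min (by linarith) (by positivity), ?_⟩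
  rintro ε ⟨ε0, hε⟩ n hν'
  obtain ⟨ν, hν⟩ : ∃ ν, ν = -Real.log Q - n * ε := ⟨_, rfl⟩
  rw [← hν] at hν' ⊢
  set m := max ε |ν| with hm
  have m0 : 0 < m := lt_max_of_lt_left ε0
  have hmd : m < min (-Real.log Q / 2) (δ / (C * S + 1)) := max_lt hε hν'
  have hm1 : m ≤ δ / (C * S + 1) := (hmd.trans_le (min_le_right _ _)).le
  have hν1 : |ν| ≤ -Real.log Q / 2 := (hν'.trans_le (min_le_left _ _)).le
  have H1 := log_hasSum ε ε0 n
  have H2 : HasSum (fun k : ℕ => ∑ r ∈ range (N + 1), ∑ s ∈ range (N + 1 - r),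
        Q ^ (k + 1) / ((k : ℝ) + 1) ^ (2 - (r : ℤ) - (s : ℤ)) * ((bernoulli r : ℝ) /
          ((r.factorial : ℝ) * (s.factorial : ℝ)) * ν ^ s * ε ^ ((r : ℤ) - 1)))
      (∑ r ∈ range (N + 1), ∑ s ∈ range (N + 1 - r),
        polylog (2 - (r : ℤ) - (s : ℤ)) Q * ((bernoulli r : ℝ) /
          ((r.factorial : ℝ) * (s.factorial : ℝ)) * ν ^ s * ε ^ ((r : ℤ) - 1))) :=
    hasSum_sum fun r _ => hasSum_sum fun s _ => (polylog_hasSum _ Q Q0.le Q1).mul_right _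
  have H := H1.add H2
  have e : ∑ r ∈ range (N + 1), ∑ s ∈ range (N + 1 - r),
        polylog (2 - (r : ℤ) - (s : ℤ)) Q * ((bernoulli r : ℝ) /
          ((r.factorial : ℝ) * (s.factorial : ℝ)) * ν ^ s * ε ^ ((r : ℤ) - 1))
      = ∑ r ∈ range (N + 1), ∑ s ∈ range (N + 1 - r),
        polylog (2 - (r : ℤ) - (s : ℤ)) Q * (bernoulli r : ℝ) /
          ((r.factorial : ℝ) * (s.factorial : ℝ)) * ν ^ s * ε ^ ((r : ℤ) - 1) :=
    sum_congr rfl fun r _ => sum_congr rfl fun s _ => by ring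
  rw [e] at H
  rw [← H.tsum_eq, ← Real.norm_eq_abs]
  have hG := hsum.hasSum.mul_left (C * m ^ (N + 1) / ε)
  refine (tsum_of_norm_bounded hG fun k => ?_).trans ?_
  · rw [term_identity Q Q0 N ε ν ((k : ℝ) + 1) k n ε0 rfl hν]
    set K : ℝ := (k : ℝ) + 1 with hK
    have K1 : 1 ≤ K := by rw [hK]; linarith [(Nat.cast_nonneg k : (0:ℝ) ≤ k)]
    have K0 : 0 < K := by linarith
    have hbk := hb (K * ε) (K * ν) (K * m) (by positivity) (by gcongr; exact le_max_left _ _)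
      (by rw [abs_mul, abs_of_pos K0]; gcongr; exact le_max_right _ _)
    rw [norm_mul, norm_neg, Real.norm_of_nonneg (by positivity), Real.norm_eq_abs]
    have hxk : Q ^ (k + 1) * Real.exp |K * ν| ≤ x ^ (k + 1) := by
      have h1 : Real.exp |K * ν| = Real.exp |ν| ^ (k + 1) := by
        rw [← Real.exp_nat_mul, abs_mul, abs_of_pos K0, hK]; push_cast; rfl
      rw [h1, ← mul_pow]
      gcongr
      rw [hx]
      nth_rw 1 [← Real.exp_log Q0]
      rw [← Real.exp_add, Real.exp_le_exp]
      linarith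
    calc _ ≤ Q ^ (k + 1) / (K ^ 2 * ε) * (C * (K * m) ^ (N + 1) * Real.exp |K * ν|) := by gcongr
      _ = (Q ^ (k + 1) * Real.exp |K * ν|) * (C * m ^ (N + 1) / ε) * (K ^ (N + 1) / K ^ 2) := by
        rw [mul_pow]; field_simp
      _ ≤ x ^ (k + 1) * (C * m ^ (N + 1) / ε) * K ^ (N + 1) := by
        gcongr
        exact div_le_self (by positivity) (one_le_pow₀ K1)
      _ = _ := by ring
  · rw [div_mul_eq_mul_div, ← hS]
    refine div_le_div_of_nonneg_right ?_ ε0.le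
    rw [le_div_iff₀ (by positivity)] at hm1
    have : C * m ^ (N + 1) * S = (C * S * m) * m ^ N := by ring
    rw [this]
    gcongr
    linarith
end

section
/- Let r ≥ 1, let A be a real positive definite symmetric r×r matrix, B ∈ ℝ^r, C ∈ ℝ. Let (Q₁,…,Q_r) be the unique solution of the Nahm system 1 − Q_i = ∏_{j=1}^r Q_j^{A_{ij}} with all Q_i ∈ (0,1). Set ξ_i = Q_i/(1−Q_i), let Ã = A + diag(ξ₁,…,ξ_r), and define α = ∑_{i=1}^r (π²/6 − L(Q_i)), β = det(Ã)^{−1/2} · ∏_{i=1}^r Q_i^{B_i}(1−Q_i)^{−1/2}, γ = C + (1/24)∑_{i=1}^r (1+Q_i)/(1−Q_i). Then α > 0, β > 0, and there exists a sequence of real numbers (c_p)_{p≥1} such that for every N ∈ ℕ, F_{A,B,C}(e^{−ε})·e^{−α/ε} − β·e^{−γε}·(1 + ∑_{p=1}^N c_p ε^p) = o(ε^N) as ε → 0+. -/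
open Real Asymptotics

/-- The `q`-Pochhammer symbol `(q;q)_n = ∏_{k=1}^n (1 - q^k)`. -/
noncomputable def qPoch (q : ℝ) (n : ℕ) : ℝ := ∏ k ∈ Finset.range n, (1 - q ^ (k + 1))

/-- The Nahm sum `F_{A,B,C}(q) = ∑_{n ∈ (ℤ_{≥0})^ι} q^{½nᵀAn + nᵀB + C} / ∏ᵢ (q)_{nᵢ}`. -/
noncomputable def nahmSum {ι : Type*} [Fintype ι]
    (A : Matrix ι ι ℝ) (B : ι → ℝ) (C : ℝ) (q : ℝ) : ℝ :=
  ∑' n : ι → ℕ,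
    q ^ ((1 / 2) * (∑ i, ∑ j, (n i : ℝ) * A i j * (n j : ℝ)) +
          (∑ i, (n i : ℝ) * B i) + C) / ∏ i, qPoch q (n i)

/-- The dilogarithm `Li₂(x) = ∑_{k ≥ 1} x^k / k²`. -/
noncomputable def dilog (x : ℝ) : ℝ := ∑' k : ℕ, x ^ (k + 1) / ((k : ℝ) + 1) ^ 2

/-- The Rogers dilogarithm `L(x) = Li₂(x) + ½ log x log (1-x)` (for `x ∈ (0,1)`). -/
noncomputable def rogersL (x : ℝ) : ℝ := dilog x + (1 / 2) * Real.log x * Real.log (1 - x)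

theorem exp_rem_s4 (N : ℕ) : ∀ w : ℂ,
    ‖Complex.exp w - ∑ k ∈ Finset.range N, w ^ k / (k.factorial : ℂ)‖
      ≤ ‖w‖ ^ N * max 1 (Real.exp w.re) := by
  induction N with
  | zero => intro w; simp [Complex.norm_exp]
  | succ N ih =>
    intro w
    have hder : ∀ t : ℝ, HasDerivAt (fun t : ℝ => Complex.exp (t * w) -
        ∑ k ∈ Finset.range (N + 1), ((t : ℂ) * w) ^ k / (k.factorial : ℂ))
        (w * (Complex.exp (t * w) - ∑ k ∈ Finset.range N, ((t : ℂ) * w) ^ k / (k.factorial : ℂ))) t := by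
      intro t
      have h1 : HasDerivAt (fun t : ℝ => (t : ℂ) * w) w t := by
        simpa using (Complex.ofRealCLM.hasDerivAt (x := t)).mul_const w
      have h2 := h1.cexp
      have h3 : HasDerivAt (fun t : ℝ => ∑ k ∈ Finset.range (N + 1),
          ((t : ℂ) * w) ^ k / (k.factorial : ℂ))
          (∑ k ∈ Finset.range (N+1), ((k : ℂ) * ((t : ℂ) * w) ^ (k-1) * w) / (k.factorial : ℂ)) t := by
        apply HasDerivAt.fun_sum
        intro k _
        exact (h1.pow k).div_const _
      refine (h2.sub h3).congr_deriv ?_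
      rw [Finset.sum_range_succ', mul_sub, Finset.mul_sum]
      simp only [Nat.cast_zero, zero_mul, zero_div, add_zero]
      congr 1
      · ring
      · apply Finset.sum_congr rfl
        intro k _
        rw [Nat.factorial_succ]
        push_cast
        have : (k : ℂ) + 1 ≠ 0 := by exact_mod_cast Nat.succ_ne_zero k
        have : (k.factorial : ℂ) ≠ 0 := by exact_mod_cast Nat.factorial_ne_zero k
        field_simp
    have hb : ∀ t ∈ Set.Ico (0:ℝ) 1, ‖w * (Complex.exp (t * w) - ∑ k ∈ Finset.range N, ((t : ℂ) * w) ^ k / (k.factorial : ℂ))‖ ≤ ‖w‖ ^ (N+1) * max 1 (Real.exp w.re) := by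
      intro t ht
      rw [norm_mul, pow_succ', mul_assoc]
      gcongr
      refine (ih _).trans ?_
      have h1 : ‖(t:ℂ) * w‖ ≤ ‖w‖ := by
        rw [norm_mul, Complex.norm_real, Real.norm_of_nonneg ht.1]
        exact mul_le_of_le_one_left (norm_nonneg _) ht.2.le
      gcongr ?_ ^ N * ?_
      have : ((t:ℂ) * w).re = t * w.re := by simp
      rw [this]
      refine max_le (le_max_left _ _) ?_
      rcases le_total w.re 0 with h | h
      · refine le_trans ?_ (le_max_left _ _)
        rw [Real.exp_le_one_iff]
        exact mul_nonpos_of_nonneg_of_nonpos ht.1 h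
      · refine le_trans ?_ (le_max_right _ _)
        rw [Real.exp_le_exp]
        exact mul_le_of_le_one_left h ht.2.le
    have := norm_image_sub_le_of_norm_deriv_le_segment_01' (fun t _ => (hder t).hasDerivWithinAt) hb
    simpa [Finset.sum_range_succ'] using this

noncomputable def gB (B y : ℝ) : ℝ := y * Real.exp (-B * y) / (1 - Real.exp (-y))

theorem gB_pos (B : ℝ) {y : ℝ} (hy : 0 < y) : 0 < gB B y := by
  unfold gB
  have : Real.exp (-y) < 1 := by rw [Real.exp_lt_one_iff]; linarith
  have : 0 < 1 - Real.exp (-y) := by linarith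
  positivity

theorem gB_expansion (B : ℝ) : ∃ g : ℕ → ℝ, g 0 = 1 ∧ g 1 = 1/2 - B ∧
    ∀ M, ∃ C, 0 ≤ C ∧ ∀ y : ℝ, 0 < y →
      |gB B y - ∑ m ∈ Finset.range M, g m * y ^ m| ≤ C * y ^ M * Real.exp ((|B| + 1) * y) := by
  set D : ℝ → ℝ := dslope (fun y => 1 - Real.exp (-y)) 0 with hD
  have hf : HasDerivAt (fun y : ℝ => 1 - Real.exp (-y)) 1 0 := by
    have := ((hasDerivAt_id (0:ℝ)).neg.exp).const_sub 1
    simpa using this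
  have hD0 : D 0 = 1 := by rw [hD, dslope_same, hf.deriv]
  have hDne : ∀ y, y ≠ 0 → D y = (1 - Real.exp (-y)) / y := by
    intro y hy
    rw [hD, dslope_of_ne _ hy, slope_def_field]; simp
  have hDan : AnalyticAt ℝ D 0 := by
    have : AnalyticAt ℝ (fun y : ℝ => 1 - Real.exp (-y)) 0 := by fun_prop
    obtain ⟨p, hp⟩ := this
    exact hp.has_fpower_series_dslope_fslope.analyticAt
  have hDder : HasDerivAt D (-1/2) 0 := by
    rw [hasDerivAt_iff_isLittleO]
    have h3 := (Real.exp_sub_sum_range_isBigO_pow 3).comp_tendsto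
      (show Filter.Tendsto (fun y : ℝ => -y) (nhds 0) (nhds 0) by
        simpa using (continuous_neg.tendsto (0:ℝ)))
    rw [isBigO_iff] at h3
    obtain ⟨c, hc⟩ := h3
    have h2 : (fun y => D y - D 0 - (y - 0) • (-1/2 : ℝ)) =O[nhds 0] (fun y : ℝ => y ^ 2) := by
      rw [isBigO_iff]
      refine ⟨c, ?_⟩
      filter_upwards [hc] with y hy
      rcases eq_or_ne y 0 with rfl | h0
      · simp
      · simp only [Function.comp, Finset.sum_range_succ, Finset.sum_range_zero] at hy
        norm_num at hy
        rw [hDne y h0, hD0]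
        have : (1 - Real.exp (-y)) / y - 1 - (y - 0) • (-1/2:ℝ) =
          -(Real.exp (-y) - (1 + -y + y^2/2)) / y := by
          simp only [smul_eq_mul]; field_simp; ring
        rw [this, norm_div, norm_neg, div_le_iff₀ (norm_pos_iff.2 h0)]
        simp only [Real.norm_eq_abs, abs_pow] at *
        calc _ ≤ c * |y| ^ 3 := hy
          _ = _ := by ring
    refine h2.trans_isLittleO ?_
    have := isLittleO_pow_pow (𝕜 := ℝ) (show 1 < 2 by norm_num)
    simpa using this
  set G : ℝ → ℝ := fun y => Real.exp (-B * y) / D y with hG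
  have hGan : AnalyticAt ℝ G 0 := by
    apply AnalyticAt.div _ hDan (by rw [hD0]; norm_num)
    fun_prop
  have hGne : ∀ y, 0 < y → G y = gB B y := by
    intro y hy
    rw [hG]; simp only [hDne y hy.ne', gB]
    field_simp
  have hGder : HasDerivAt G (1/2 - B) 0 := by
    have h1 : HasDerivAt (fun y : ℝ => Real.exp (-B * y)) (-B) 0 := by
      have := ((hasDerivAt_id (0:ℝ)).const_mul (-B)).exp
      simpa using this
    have := h1.div hDder (by rw [hD0]; norm_num)
    refine this.congr_deriv ?_
    rw [hD0]; simp; ring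
  obtain ⟨p, hp⟩ := hGan
  refine ⟨fun n => p.coeff n, ?_, ?_, ?_⟩
  · have h2 := hp.coeff_zero (1 : Fin 0 → ℝ)
    refine Eq.trans h2 ?_
    rw [hG]; simp [hD0]
  · have := hp.hasDerivAt
    have h2 := this.unique hGder
    rw [← h2]; rfl
  · intro M
    set S : ℝ → ℝ := fun y => ∑ m ∈ Finset.range M, p.coeff m * y ^ m with hS
    have hO := hp.isBigO_sub_partialSum_pow M
    rw [isBigO_iff] at hO
    obtain ⟨c, hc⟩ := hO
    rw [Metric.eventually_nhds_iff] at hc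
    obtain ⟨η, hη, hc⟩ := hc
    -- large y bound
    have hlarge : ∃ C', 0 ≤ C' ∧ ∀ y, η ≤ y → |gB B y - S y| ≤ C' * y ^ M * Real.exp ((|B| + 1) * y) := by
      have he : Real.exp (-η) < 1 := by rw [Real.exp_lt_one_iff]; linarith
      refine ⟨((1 - Real.exp (-η))⁻¹ + ∑ m ∈ Finset.range M, |p.coeff m| * m.factorial) * (1 / η ^ M), ?_, ?_⟩
      · have : 0 < 1 - Real.exp (-η) := by linarith
        positivity
      intro y hy
      have hy0 : 0 < y := hη.trans_le hy
      have h1 : |gB B y| ≤ (1 - Real.exp (-η))⁻¹ * Real.exp ((|B| + 1) * y) := by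
        rw [abs_of_pos (gB_pos B hy0), gB, div_eq_inv_mul]
        have : Real.exp (-y) ≤ Real.exp (-η) := by rw [Real.exp_le_exp]; linarith
        have h4 : y ≤ Real.exp y := by linarith [Real.add_one_le_exp y]
        have h5 : Real.exp (-B * y) ≤ Real.exp (|B| * y) := by
          rw [Real.exp_le_exp]; gcongr; exact neg_le_abs B
        have h6 : Real.exp ((|B| + 1) * y) = Real.exp y * Real.exp (|B| * y) := by
          rw [← Real.exp_add]; ring_nf
        rw [h6]
        have : 0 < 1 - Real.exp (-η) := by linarith
        gcongr
      have h2 : |S y| ≤ (∑ m ∈ Finset.range M, |p.coeff m| * m.factorial) * Real.exp ((|B| + 1) * y) := by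
        rw [hS]
        refine (Finset.abs_sum_le_sum_abs _ _).trans ?_
        rw [Finset.sum_mul]
        apply Finset.sum_le_sum
        intro m _
        rw [abs_mul, mul_assoc]
        gcongr
        have := Real.pow_div_factorial_le_exp y hy0.le m
        rw [div_le_iff₀ (by positivity)] at this
        rw [abs_of_nonneg (by positivity), mul_comm]
        refine this.trans ?_
        gcongr
        nlinarith [abs_nonneg B]
      have h3 : 1 ≤ 1 / η ^ M * y ^ M := by
        rw [one_div, inv_mul_eq_div, one_le_div (by positivity)]
        gcongr
      calc |gB B y - S y| ≤ |gB B y| + |S y| := abs_sub _ _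
        _ ≤ ((1 - Real.exp (-η))⁻¹ + ∑ m ∈ Finset.range M, |p.coeff m| * m.factorial) * Real.exp ((|B| + 1) * y) * 1 := by linarith
        _ ≤ ((1 - Real.exp (-η))⁻¹ + ∑ m ∈ Finset.range M, |p.coeff m| * m.factorial) * Real.exp ((|B| + 1) * y) * (1 / η ^ M * y ^ M) := by
          have : 0 < 1 - Real.exp (-η) := by linarith
          gcongr
        _ = _ := by ring
    obtain ⟨C', hC', hl⟩ := hlarge
    refine ⟨max |c| C', by positivity, ?_⟩
    intro y hy
    rcases lt_or_ge y η with h | h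
    · have := hc (y := y) (by simpa [abs_of_pos hy] using h)
      simp only [zero_add, FormalMultilinearSeries.partialSum, FormalMultilinearSeries.apply_eq_pow_smul_coeff, smul_eq_mul, hGne y hy] at this
      simp only [Real.norm_eq_abs, abs_pow, abs_of_pos hy] at this
      have h2 : |gB B y - ∑ m ∈ Finset.range M, p.coeff m * y ^ m| ≤ c * y ^ M := by
        simpa [mul_comm] using this
      refine h2.trans ?_
      have h3 : 1 ≤ Real.exp ((|B| + 1) * y) := Real.one_le_exp (by positivity)
      calc c * y ^ M ≤ max |c| C' * y ^ M * 1 := by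
            rw [mul_one]; gcongr; exact (le_abs_self c).trans (le_max_left _ _)
        _ ≤ _ := by gcongr
    · refine (hl y h).trans ?_
      gcongr
      exact le_max_right _ _

theorem qPoch_pos {q : ℝ} (h0 : 0 < q) (h1 : q < 1) (n : ℕ) : 0 < qPoch q n := by
  unfold qPoch
  apply Finset.prod_pos
  intro k _
  have := pow_lt_one₀ h0.le h1 (k.add_one_ne_zero)
  linarith

theorem qPoch_succ (q : ℝ) (n : ℕ) : qPoch q (n+1) = qPoch q n * (1 - q ^ (n+1)) := by
  simp [qPoch, Finset.prod_range_succ]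

theorem euler_summable {q : ℝ} (h0 : 0 < q) (h1 : q < 1) {x : ℝ} (hx0 : 0 ≤ x) (hx1 : x < 1) :
    Summable (fun n : ℕ => x ^ n / qPoch q n) := by
  obtain ⟨ρ, hρ, hρ1⟩ := exists_between hx1
  have hlim : Filter.Tendsto (fun n : ℕ => ρ * (1 - q ^ (n+1))) Filter.atTop (nhds (ρ * (1 - 0))) := by
    apply Filter.Tendsto.const_mul
    apply Filter.Tendsto.const_sub
    exact (tendsto_pow_atTop_nhds_zero_of_lt_one h0.le h1).comp (Filter.tendsto_add_atTop_nat 1)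
  refine summable_of_ratio_norm_eventually_le (r := ρ) hρ1 ?_
  have hev := hlim.eventually (lt_mem_nhds (show x < ρ * (1 - 0) by linarith))
  filter_upwards [hev] with n hn
  have hp := qPoch_pos h0 h1 n
  have hp1 := qPoch_pos h0 h1 (n+1)
  rw [Real.norm_of_nonneg (by positivity), Real.norm_of_nonneg (by positivity), pow_succ]
  rw [← mul_div_assoc, div_le_div_iff₀ hp1 hp, qPoch_succ]
  have : 0 ≤ x ^ n * qPoch q n := by positivity
  nlinarith

theorem euler_log_bound {q : ℝ} (h0 : 0 < q) (h1 : q < 1) (z : ℂ) (k : ℕ) :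
    ‖z ^ (k+1) / (((k:ℂ)+1) * (1 - (q:ℂ) ^ (k+1)))‖ ≤ ‖z‖ ^ (k+1) / (1 - q) := by
  rw [norm_div, norm_pow]
  have e : ((k:ℂ)+1) * (1 - (q:ℂ) ^ (k+1)) = ((((k:ℝ)+1) * (1 - q ^ (k+1)) : ℝ) : ℂ) := by
    push_cast; ring
  have hq : q ^ (k+1) ≤ q := by
    rw [pow_succ]; exact mul_le_of_le_one_left h0.le (pow_le_one₀ h0.le h1.le)
  have h2 : 1 - q ≤ ((k:ℝ)+1) * (1 - q ^ (k+1)) := by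
    have : (0:ℝ) ≤ k := Nat.cast_nonneg k
    nlinarith
  have h3 : 0 < 1 - q := by linarith
  rw [e, Complex.norm_real, Real.norm_of_nonneg (h3.le.trans h2)]
  gcongr

theorem euler_identity {q : ℝ} (h0 : 0 < q) (h1 : q < 1) {z : ℂ} (hz : ‖z‖ < 1) :
    ∑' n : ℕ, z ^ n / (qPoch q n : ℂ) =
      Complex.exp (∑' k : ℕ, z ^ (k+1) / (((k:ℂ)+1) * (1 - (q:ℂ) ^ (k+1)))) := by
  have h3 : 0 < 1 - q := by linarith
  set F : ℂ → ℂ := fun z => ∑' n : ℕ, z ^ n / (qPoch q n : ℂ) with hF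
  set S : ℂ → ℂ := fun z => ∑' k : ℕ, z ^ (k+1) / (((k:ℂ)+1) * (1 - (q:ℂ) ^ (k+1))) with hS
  have hnorm : ∀ (z : ℂ) (n : ℕ), ‖z ^ n / (qPoch q n : ℂ)‖ = ‖z‖ ^ n / qPoch q n := by
    intro z n
    rw [norm_div, norm_pow, Complex.norm_real, Real.norm_of_nonneg (qPoch_pos h0 h1 n).le]
  have hFs : ∀ z : ℂ, ‖z‖ < 1 → Summable (fun n : ℕ => z ^ n / (qPoch q n : ℂ)) := by
    intro z hz
    apply Summable.of_norm
    simp only [hnorm]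
    exact euler_summable h0 h1 (norm_nonneg _) hz
  have hgs : ∀ z : ℂ, ‖z‖ < 1 → Summable (fun k : ℕ => ‖z‖ ^ (k+1) / (1 - q)) := by
    intro z hz
    apply Summable.div_const
    exact (summable_nat_add_iff 1).2 (summable_geometric_of_lt_one (norm_nonneg _) hz)
  have hSs : ∀ z : ℂ, ‖z‖ < 1 → Summable (fun k : ℕ => z ^ (k+1) / (((k:ℂ)+1) * (1 - (q:ℂ) ^ (k+1)))) := by
    intro z hz
    exact Summable.of_norm_bounded (hgs z hz) (euler_log_bound h0 h1 z)
  have hqz : ∀ z : ℂ, ‖z‖ < 1 → ‖(q:ℂ) * z‖ < 1 := by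
    intro z hz
    rw [norm_mul, Complex.norm_real, Real.norm_of_nonneg h0.le]
    nlinarith [norm_nonneg z]
  have hFq : ∀ z : ℂ, ‖z‖ < 1 → F (q * z) = (1 - z) * F z := by
    intro z hz
    have e1 : F z - F (q * z) = z * F z := by
      rw [hF]
      simp only
      rw [← (hFs z hz).tsum_sub (hFs _ (hqz z hz)), ((hFs z hz).sub (hFs _ (hqz z hz))).tsum_eq_zero_add, ← tsum_mul_left]
      simp only [pow_zero, sub_self, zero_add]
      apply tsum_congr
      intro n
      have hp : (qPoch q n : ℂ) ≠ 0 := by exact_mod_cast (qPoch_pos h0 h1 n).ne'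
      have hq : (1 - (q:ℂ) ^ (n+1)) ≠ 0 := by
        have := pow_lt_one₀ h0.le h1 (n.add_one_ne_zero)
        have : (1 - q ^ (n+1)) ≠ 0 := by linarith
        exact_mod_cast this
      rw [qPoch_succ]
      push_cast
      rw [mul_pow]
      field_simp
      ring
    linear_combination -e1
  have hSq : ∀ z : ℂ, ‖z‖ < 1 → S z - S (q * z) = -Complex.log (1 - z) := by
    intro z hz
    rw [hS]
    simp only
    rw [← (hSs z hz).tsum_sub (hSs _ (hqz z hz))]
    have := Complex.hasSum_taylorSeries_neg_log hz
    rw [← this.tsum_eq, this.summable.tsum_eq_zero_add]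
    simp only [pow_zero, Nat.cast_zero, div_zero, zero_add]
    apply tsum_congr
    intro n
    have hq : (1 - (q:ℂ) ^ (n+1)) ≠ 0 := by
      have := pow_lt_one₀ h0.le h1 (n.add_one_ne_zero)
      have : (1 - q ^ (n+1)) ≠ 0 := by linarith
      exact_mod_cast this
    have : (n : ℂ) + 1 ≠ 0 := by exact_mod_cast Nat.succ_ne_zero n
    rw [mul_pow]
    push_cast
    field_simp
  have hR : ∀ z : ℂ, ‖z‖ < 1 → F (q * z) * Complex.exp (-S (q*z)) = F z * Complex.exp (-S z) := by
    intro z hz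
    have hne : (1 - z) ≠ 0 := by
      intro h
      have : z = 1 := by linear_combination -h
      rw [this] at hz; simp at hz
    have : -S (q*z) = -S z - Complex.log (1 - z) := by linear_combination hSq z hz
    rw [this, Complex.exp_sub, Complex.exp_log hne, hFq z hz]
    field_simp
  have hzn : ∀ n : ℕ, ‖(q:ℂ)^n * z‖ ≤ ‖z‖ := by
    intro n
    rw [norm_mul, norm_pow, Complex.norm_real, Real.norm_of_nonneg h0.le]
    exact mul_le_of_le_one_left (norm_nonneg _) (pow_le_one₀ h0.le h1.le)
  have hRn : ∀ n : ℕ, F (q ^ n * z) * Complex.exp (-S (q^n*z)) = F z * Complex.exp (-S z) := by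
    intro n
    induction n with
    | zero => simp
    | succ n ih =>
      rw [← ih, ← hR _ ((hzn n).trans_lt hz), pow_succ']
      simp only [mul_assoc]
  have hq0 : Filter.Tendsto (fun n : ℕ => (q:ℂ) ^ n * z) Filter.atTop (nhds 0) := by
    have : Filter.Tendsto (fun n : ℕ => (q:ℂ) ^ n) Filter.atTop (nhds 0) := by
      apply tendsto_pow_atTop_nhds_zero_of_norm_lt_one
      rwa [Complex.norm_real, Real.norm_of_nonneg h0.le]
    simpa using this.mul_const z
  have hFt : Filter.Tendsto (fun n : ℕ => F (q ^ n * z)) Filter.atTop (nhds (F 0)) := by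
    apply tendsto_tsum_of_dominated_convergence (euler_summable h0 h1 (norm_nonneg z) hz)
    · intro k
      exact (hq0.pow k).div_const _
    · refine Filter.Eventually.of_forall fun n k => ?_
      rw [hnorm]
      have := qPoch_pos h0 h1 k
      gcongr
      exact hzn n
  have hSt : Filter.Tendsto (fun n : ℕ => S (q ^ n * z)) Filter.atTop (nhds (S 0)) := by
    apply tendsto_tsum_of_dominated_convergence (hgs z hz)
    · intro k
      exact (hq0.pow (k+1)).div_const _
    · refine Filter.Eventually.of_forall fun n k => ?_
      refine (euler_log_bound h0 h1 _ k).trans ?_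
      gcongr
      exact hzn n
  have hF0 : F 0 = 1 := by
    rw [hF]; simp only
    rw [tsum_eq_single 0]
    · simp [qPoch]
    · intro n hn; simp [hn]
  have hS0 : S 0 = 0 := by
    rw [hS]; simp
  have hlim : Filter.Tendsto (fun n : ℕ => F (q ^ n * z) * Complex.exp (-S (q^n*z))) Filter.atTop
      (nhds (F 0 * Complex.exp (-S 0))) := hFt.mul ((Complex.continuous_exp.tendsto _).comp hSt.neg)
  simp only [hRn] at hlim
  have := tendsto_nhds_unique hlim tendsto_const_nhds
  rw [hF0, hS0] at this
  simp only [neg_zero, Complex.exp_zero, mul_one] at this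
  change F z = Complex.exp (S z)
  rw [Complex.exp_neg] at this
  field_simp at this
  exact this.symm

/-- product of sums over a finite family -/
theorem hasSum_pi_prod {r : ℕ} : ∀ (a : Fin r → ℕ → ℂ), (∀ i, Summable fun n => ‖a i n‖) →
    (Summable fun n : Fin r → ℕ => ‖∏ i, a i (n i)‖) ∧
    ∑' n : Fin r → ℕ, ∏ i, a i (n i) = ∏ i, ∑' n, a i n := by
  induction r with
  | zero =>
    intro a _
    refine ⟨(hasSum_fintype _).summable, ?_⟩
    simp
  | succ r ih =>
    intro a ha
    obtain ⟨h1, h2⟩ := ih (fun i => a i.succ) (fun i => ha _)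
    have key : ∀ p : ℕ × (Fin r → ℕ), ∏ i, a i (Fin.consEquiv (fun _ => ℕ) p i) =
        a 0 p.1 * ∏ i : Fin r, a i.succ (p.2 i) := by
      intro p
      rw [Fin.prod_univ_succ]; simp
    have hs : Summable fun p : ℕ × (Fin r → ℕ) => ‖a 0 p.1 * ∏ i : Fin r, a i.succ (p.2 i)‖ := by
      have := (ha 0).mul_of_nonneg h1 (fun _ => norm_nonneg _) (fun _ => norm_nonneg _)
      simpa only [norm_mul] using this
    constructor
    · rw [← (Fin.consEquiv (fun _ : Fin (r+1) => ℕ)).summable_iff]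
      refine hs.congr ?_
      intro p
      simp only [Function.comp_apply, key]
    · rw [← (Fin.consEquiv (fun _ : Fin (r+1) => ℕ)).tsum_eq]
      simp only [key]
      rw [Fin.prod_univ_succ, ← h2]
      rw [tsum_mul_tsum_of_summable_norm (ha 0) h1]

theorem dilog_summand_bound {x : ℝ} (h0 : 0 ≤ x) (h1 : x ≤ 1) (k : ℕ) :
    ‖x ^ (k + 1) / ((k : ℝ) + 1) ^ 2‖ ≤ 1 / ((k:ℝ) + 1) ^ 2 := by
  rw [Real.norm_of_nonneg (by positivity)]
  gcongr
  exact pow_le_one₀ h0 h1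

theorem summable_inv_sq_succ : Summable (fun k : ℕ => 1 / ((k:ℝ) + 1) ^ 2) := by
  have := (summable_nat_add_iff 1).2 hasSum_zeta_two.summable
  simpa using this

theorem dilog_one : dilog 1 = π ^ 2 / 6 := by
  have := hasSum_zeta_two
  rw [← this.tsum_eq, this.summable.tsum_eq_zero_add]
  simp [dilog]

theorem dilog_zero : dilog 0 = 0 := by simp [dilog]

theorem dilog_continuousOn : ContinuousOn dilog (Set.Icc 0 1) := by
  unfold dilog
  apply continuousOn_tsum (u := fun k : ℕ => 1 / ((k:ℝ) + 1) ^ 2)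
  · intro k; fun_prop
  · exact summable_inv_sq_succ
  · intro k x hx
    exact dilog_summand_bound hx.1 hx.2 k

theorem dilog_hasDerivAt {x : ℝ} (h0 : 0 < x) (h1 : x < 1) :
    HasDerivAt dilog (-Real.log (1 - x) / x) x := by
  obtain ⟨ρ, hρ, hρ1⟩ := exists_between h1
  have hs : HasSum (fun n : ℕ => x ^ n / ((n:ℝ) + 1)) (-Real.log (1 - x) / x) := by
    have := Real.hasSum_pow_div_log_of_abs_lt_one (x := x) (by rw [abs_of_pos h0]; exact h1)
    have := this.div_const x
    refine this.congr_fun ?_ |> fun h => h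
    intro n
    field_simp
    ring
  rw [← hs.tsum_eq]
  unfold dilog
  refine hasDerivAt_tsum_of_isPreconnected (u := fun n => ρ ^ n) (t := Set.Ioo 0 ρ)
    (summable_geometric_of_lt_one (by linarith) hρ1) isOpen_Ioo isPreconnected_Ioo
    (g := fun (k : ℕ) x => x ^ (k + 1) / ((k : ℝ) + 1) ^ 2)
    (g' := fun n x => x ^ n / ((n:ℝ) + 1)) ?_ ?_ (y₀ := x) ⟨h0, hρ⟩ ?_ ⟨h0, hρ⟩
  · intro n y _
    have := (hasDerivAt_pow (n+1) y).div_const (((n:ℝ)+1)^2)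
    refine this.congr_deriv ?_
    push_cast
    field_simp
  · intro n y hy
    have : 0 < y := hy.1
    rw [Real.norm_of_nonneg (by positivity)]
    have h3 : (1:ℝ) ≤ (n:ℝ) + 1 := by linarith [(Nat.cast_nonneg n : (0:ℝ) ≤ n)]
    calc y ^ n / ((n:ℝ)+1) ≤ y ^ n / 1 := by gcongr
      _ ≤ ρ ^ n := by rw [div_one]; gcongr; exact hy.2.le
  · exact Summable.of_norm_bounded summable_inv_sq_succ (dilog_summand_bound h0.le h1.le)

theorem dilog_reflection {x : ℝ} (h0 : 0 < x) (h1 : x < 1) :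
    dilog x + dilog (1 - x) = π ^ 2 / 6 - Real.log x * Real.log (1 - x) := by
  set h : ℝ → ℝ := fun x => dilog x + dilog (1 - x) + Real.log x * Real.log (1 - x) with hh
  have hder : ∀ y ∈ Set.Ioo (0:ℝ) 1, HasDerivAt h 0 y := by
    intro y hy
    have e1 := dilog_hasDerivAt hy.1 hy.2
    have i : HasDerivAt (fun y : ℝ => 1 - y) (-1) y := (hasDerivAt_id y).const_sub 1
    have e2 := (dilog_hasDerivAt (x := 1 - y) (by linarith [hy.2]) (by linarith [hy.1])).comp y i
    have hy0 : y ≠ 0 := hy.1.ne'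
    have hy1 : 1 - y ≠ 0 := by linarith [hy.2]
    have e3 := (Real.hasDerivAt_log hy0).mul (i.log hy1)
    refine ((e1.add e2).add e3).congr_deriv ?_
    rw [sub_sub_cancel]
    field_simp
    ring
  have hconst : ∀ y ∈ Set.Ioo (0:ℝ) 1, h y = h x := by
    intro y hy
    exact (isOpen_Ioo).is_const_of_deriv_eq_zero isPreconnected_Ioo
      (fun z hz => (hder z hz).differentiableAt.differentiableWithinAt)
      (fun z hz => (hder z hz).deriv) hy ⟨h0, h1⟩
  have hlim : Filter.Tendsto h (nhdsWithin 0 (Set.Ioo 0 1)) (nhds (0 + π ^ 2 / 6 + 0)) := by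
    refine Filter.Tendsto.add (Filter.Tendsto.add ?_ ?_) ?_
    · have := (dilog_continuousOn 0 (by simp)).mono (Set.Ioo_subset_Icc_self)
      rw [ContinuousWithinAt, dilog_zero] at this
      exact this
    · have := (dilog_continuousOn 1 (by simp))
      rw [ContinuousWithinAt, dilog_one] at this
      refine this.comp ?_
      apply tendsto_nhdsWithin_of_tendsto_nhds_of_eventually_within
      · have : Filter.Tendsto (fun x : ℝ => 1 - x) (nhds 0) (nhds (1 - 0)) :=
          (continuous_const.sub continuous_id).tendsto 0
        rw [sub_zero] at this
        exact this.mono_left nhdsWithin_le_nhds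
      · filter_upwards [self_mem_nhdsWithin] with y hy
        constructor <;> linarith [hy.1, hy.2]
    · have ht : Filter.Tendsto (fun y : ℝ => 2 * |Real.log y * y|) (nhdsWithin 0 (Set.Ioo 0 1)) (nhds 0) := by
        have h3 := (tendsto_log_mul_rpow_nhdsGT_zero (r := 1) one_pos)
        simp only [Real.rpow_one] at h3
        have := (h3.abs).const_mul 2
        simp only [abs_zero, mul_zero] at this
        exact this.mono_left (nhdsWithin_mono _ (fun y hy => hy.1))
      refine squeeze_zero_norm' ?_ ht
      have hsm : ∀ᶠ y : ℝ in nhdsWithin 0 (Set.Ioo 0 1), y < 1/2 :=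
        nhdsWithin_le_nhds (gt_mem_nhds (by norm_num))
      filter_upwards [self_mem_nhdsWithin, hsm] with y hy hy2
      rw [Real.norm_eq_abs, abs_mul, abs_mul]
      have hlog : |Real.log (1 - y)| ≤ 2 * |y| := by
        rw [abs_of_nonpos (Real.log_nonpos (by linarith) (by linarith [hy.1])), abs_of_pos hy.1]
        have := Real.one_sub_inv_le_log_of_pos (x := 1 - y) (by linarith)
        have h5 : (1 - y)⁻¹ ≤ 1 + 2 * y := by
          rw [inv_le_iff_one_le_mul₀ (by linarith)]
          nlinarith [hy.1]
        linarith
      nlinarith [abs_nonneg (Real.log y)]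
  have hlim2 : Filter.Tendsto h (nhdsWithin 0 (Set.Ioo 0 1)) (nhds (h x)) := by
    refine tendsto_const_nhds.congr' ?_
    filter_upwards [self_mem_nhdsWithin] with y hy
    exact (hconst y hy).symm
  have hne : (nhdsWithin (0:ℝ) (Set.Ioo 0 1)).NeBot := by
    rw [nhdsWithin_Ioo_eq_nhdsGT one_pos]; infer_instance
  have := tendsto_nhds_unique hlim hlim2
  simp only [hh] at this
  linarith

theorem gauss_one_dim {m : ℝ} (hm : 0 ≤ m) :
    ∫ x, Real.exp (-(1/2) * m * x ^ 2) ∂(ProbabilityTheory.gaussianReal 0 1) = (1 + m) ^ (-(1/2) : ℝ) := by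
  rw [ProbabilityTheory.integral_gaussianReal_eq_integral_smul one_ne_zero]
  have : ∀ x : ℝ, ProbabilityTheory.gaussianPDFReal 0 1 x • Real.exp (-(1/2) * m * x ^ 2) =
      (√(2 * π))⁻¹ * Real.exp (-((1 + m)/2) * x ^ 2) := by
    intro x
    rw [ProbabilityTheory.gaussianPDFReal, smul_eq_mul, mul_assoc, ← Real.exp_add]
    simp only [NNReal.coe_one, mul_one, sub_zero]
    congr 2
    ring
  simp only [this]
  rw [MeasureTheory.integral_const_mul, integral_gaussian]
  rw [Real.rpow_neg (by linarith), ← Real.sqrt_eq_rpow, ← Real.sqrt_inv, ← Real.sqrt_inv, ← Real.sqrt_mul (by positivity)]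
  congr 1
  field_simp

open MeasureTheory ProbabilityTheory Matrix in
theorem gauss_const {r : ℕ} (A : Matrix (Fin r) (Fin r) ℝ) (hA : A.PosDef) (d : Fin r → ℝ)
    (hd : ∀ i, 0 ≤ d i) :
    ∫ s, Real.exp (-(1/2) * ∑ i, d i * (s i) ^ 2) ∂(multivariateGaussian 0 A) =
      (det (1 + diagonal d * A)) ^ (-(1/2) : ℝ) := by
  open scoped MatrixOrder in
  set R : Matrix (Fin r) (Fin r) ℝ := CFC.sqrt A with hR
  have hRR : R * R = A := by
    open scoped MatrixOrder in
    exact CFC.sqrt_mul_sqrt_self A hA.posSemidef.nonneg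
  have hRs : Rᵀ = R := by
    open scoped MatrixOrder in
    have := (CFC.sqrt_nonneg A).isSelfAdjoint
    have h2 : Rᴴ = R := this
    simpa using h2
  have hD : (diagonal d).PosSemidef := PosSemidef.diagonal hd
  set M : Matrix (Fin r) (Fin r) ℝ := R * diagonal d * R with hM
  have hMp : M.PosSemidef := by
    have := hD.mul_mul_conjTranspose_same R
    rw [conjTranspose_eq_transpose_of_trivial, hRs] at this
    exact this
  have hMh := hMp.isHermitian
  have hdet : det (1 + diagonal d * A) = ∏ i, (1 + hMh.eigenvalues i) := by
    have e1 : det (1 + diagonal d * A) = det (1 + M) := by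
      rw [hM, ← hRR, ← mul_assoc, det_one_add_mul_comm, mul_assoc]
    have e2 := congrArg (Polynomial.eval (-1)) hMh.charpoly_eq
    rw [eval_charpoly, Polynomial.eval_prod] at e2
    have e3 : (scalar (Fin r) (-1 : ℝ) - M) = -(1 + M) := by
      rw [map_neg, map_one]; abel
    rw [e3, det_neg] at e2
    have e4 : ∀ i, Polynomial.eval (-1) (Polynomial.X - Polynomial.C ((hMh.eigenvalues i : ℝ))) = (-1) * (1 + hMh.eigenvalues i) := by
      intro i; simp; ring
    rw [e1]
    have e5 : (-1:ℝ) ^ Fintype.card (Fin r) * (1 + M).det = (-1) ^ Fintype.card (Fin r) * ∏ i, (1 + hMh.eigenvalues i) := by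
      rw [e2]
      have : ∀ i, Polynomial.eval (-1) (Polynomial.X - Polynomial.C ((RCLike.ofReal (hMh.eigenvalues i) : ℝ))) = (-1) * (1 + hMh.eigenvalues i) := e4
      rw [Finset.prod_congr rfl (fun i _ => this i), Finset.prod_mul_distrib]
      simp
    exact mul_left_cancel₀ (pow_ne_zero _ (by norm_num)) e5
  rw [multivariateGaussian, integral_map (by fun_prop) (Continuous.aestronglyMeasurable (by fun_prop)),
    stdGaussian_eq_map_pi_orthonormalBasis hMh.eigenvectorBasis,
    integral_map (Measurable.aemeasurable (by fun_prop)) (Continuous.aestronglyMeasurable (by fun_prop))]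
  have hq : ∀ y : Fin r → ℝ, ∑ i, d i * (((0 : EuclideanSpace ℝ (Fin r)) + (toEuclideanCLM (𝕜 := ℝ) R) (∑ i, y i • hMh.eigenvectorBasis i)) i) ^ 2
      = ∑ j, hMh.eigenvalues j * y j ^ 2 := by
    intro y
    set x := ∑ i, y i • hMh.eigenvectorBasis i with hx
    have e1 : ∑ i, d i * (((0 : EuclideanSpace ℝ (Fin r)) + (toEuclideanCLM (𝕜 := ℝ) R) x) i) ^ 2
      = x.ofLp ⬝ᵥ (M *ᵥ x.ofLp) := by
      rw [zero_add, hM, ← mulVec_mulVec, ← mulVec_mulVec, dotProduct_mulVec, ← mulVec_transpose, hRs]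
      rw [ofLp_toEuclideanCLM]
      simp only [dotProduct, mulVec_diagonal]
      apply Finset.sum_congr rfl
      intro i _
      ring
    have e2 : (M *ᵥ x.ofLp) = (∑ i, (hMh.eigenvalues i * y i) • hMh.eigenvectorBasis i).ofLp := by
      rw [hx]
      simp only [WithLp.ofLp_sum, WithLp.ofLp_smul, mulVec_sum, mulVec_smul, hMh.mulVec_eigenvectorBasis]
      apply Finset.sum_congr rfl
      intro i _
      rw [smul_smul, mul_comm]
    have e3 : x.ofLp ⬝ᵥ (M *ᵥ x.ofLp) = inner ℝ (∑ i, (hMh.eigenvalues i * y i) • hMh.eigenvectorBasis i) x := by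
      rw [e2, EuclideanSpace.inner_eq_star_dotProduct]
      simp
    rw [e1, e3, hx, hMh.eigenvectorBasis.orthonormal.inner_sum]
    simp
    apply Finset.sum_congr rfl
    intro i _
    ring
  have hf : ∀ y : Fin r → ℝ, Real.exp (-(1/2) * ∑ j, hMh.eigenvalues j * y j ^ 2) =
      ∏ j, Real.exp (-(1/2) * hMh.eigenvalues j * y j ^ 2) := by
    intro y
    rw [← Real.exp_sum, Finset.mul_sum]
    simp only [mul_assoc]
  rw [← hR]
  simp only [hq, hf]
  rw [integral_fintype_prod_eq_prod (f := fun j y => Real.exp (-(1/2) * hMh.eigenvalues j * y ^ 2))]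
  rw [hdet, ← Real.finsetProd_rpow]
  · apply Finset.prod_congr rfl
    intro i _
    exact gauss_one_dim (hMp.eigenvalues_nonneg i)
  · intro i _
    linarith [hMp.eigenvalues_nonneg i]

section AsyClass
variable {V : Type*} [NormedAddCommGroup V]

/-- Continuous functions of polynomial growth. -/
def SR (V : Type*) [NormedAddCommGroup V] : Subring (V → ℂ) where
  carrier := {h | Continuous h ∧ ∃ (C : ℝ) (k : ℕ), 0 ≤ C ∧ ∀ s, ‖h s‖ ≤ C * (1 + ‖s‖) ^ k}
  zero_mem' := ⟨continuous_const, 0, 0, le_rfl, by simp⟩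
  one_mem' := ⟨continuous_const, 1, 0, zero_le_one, by simp⟩
  neg_mem' := by
    rintro f ⟨hf, C, k, hC, h⟩
    exact ⟨hf.neg, C, k, hC, by simpa using h⟩
  mul_mem' := by
    rintro f g ⟨hf, C, k, hC, h⟩ ⟨hg, C', k', hC', h'⟩
    refine ⟨hf.mul hg, C * C', k + k', by positivity, fun s => ?_⟩
    rw [Pi.mul_apply, norm_mul]
    calc _ ≤ (C * (1 + ‖s‖) ^ k) * (C' * (1 + ‖s‖) ^ k') := by gcongr <;> simp [h, h']
      _ = _ := by ring
  add_mem' := by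
    rintro f g ⟨hf, C, k, hC, h⟩ ⟨hg, C', k', hC', h'⟩
    refine ⟨hf.add hg, C + C', k + k', by positivity, fun s => ?_⟩
    have h1 : (1:ℝ) ≤ 1 + ‖s‖ := by linarith [norm_nonneg s]
    calc ‖f s + g s‖ ≤ C * (1 + ‖s‖) ^ k + C' * (1 + ‖s‖) ^ k' :=
          (norm_add_le _ _).trans (add_le_add (h s) (h' s))
      _ ≤ C * (1 + ‖s‖) ^ (k + k') + C' * (1 + ‖s‖) ^ (k + k') := by
          gcongr <;> first | exact h1 | omega
      _ = _ := by ring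

/-- Evaluation of a polynomial with coefficients in `SR V`. -/
noncomputable def ev (δ : ℂ) (s : V) : Polynomial (SR V) →+* ℂ :=
  Polynomial.eval₂RingHom ((Pi.evalRingHom (fun _ : V => ℂ) s).comp (SR V).subtype) δ

theorem ev_C (δ : ℂ) (s : V) (c : SR V) : ev δ s (Polynomial.C c) = (c : V → ℂ) s := by
  simp [ev]

theorem ev_X (δ : ℂ) (s : V) : ev δ s (Polynomial.X : Polynomial (SR V)) = δ := by
  simp [ev]

theorem ev_zero (s : V) (p : Polynomial (SR V)) : ev 0 s p = (p.coeff 0 : V → ℂ) s := by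
  conv_lhs => rw [← Polynomial.divX_mul_X_add p]
  simp [ev_X, ev_C]

theorem ev_sum (δ : ℂ) (s : V) (p : Polynomial (SR V)) :
    ev δ s p = ∑ n ∈ Finset.range (p.natDegree + 1), (p.coeff n : V → ℂ) s * δ ^ n := by
  simp [ev, Polynomial.eval₂_eq_sum_range]

/-- `f = O(δ^N)` with polynomial growth in `s`. -/
def ModB (N : ℕ) (f : ℝ → V → ℂ) : Prop :=
  ∃ (C : ℝ) (k : ℕ) (δ₀ : ℝ), 0 ≤ C ∧ 0 < δ₀ ∧ δ₀ ≤ 1 ∧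
    ∀ δ, 0 < δ → δ < δ₀ → ∀ s, ‖f δ s‖ ≤ C * (1 + ‖s‖) ^ k * δ ^ N

theorem ModB.congr {N : ℕ} {f g : ℝ → V → ℂ} (hf : ModB N f) {δ₁ : ℝ} (h1 : 0 < δ₁)
    (h : ∀ δ, 0 < δ → δ < δ₁ → ∀ s, ‖g δ s‖ ≤ ‖f δ s‖) : ModB N g := by
  obtain ⟨C, k, δ₀, hC, h0, h01, hb⟩ := hf
  refine ⟨C, k, min δ₀ δ₁, hC, lt_min h0 h1, (min_le_left _ _).trans h01, fun δ hδ hδ' s => ?_⟩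
  exact (h δ hδ (hδ'.trans_le (min_le_right _ _)) s).trans (hb δ hδ (hδ'.trans_le (min_le_left _ _)) s)

theorem ModB.mono {N M : ℕ} {f : ℝ → V → ℂ} (hf : ModB N f) (h : M ≤ N) : ModB M f := by
  obtain ⟨C, k, δ₀, hC, h0, h01, hb⟩ := hf
  refine ⟨C, k, δ₀, hC, h0, h01, fun δ hδ hδ' s => (hb δ hδ hδ' s).trans ?_⟩
  gcongr C * _ * ?_
  exact pow_le_pow_of_le_one hδ.le (hδ'.le.trans h01) h

theorem ModB.add {N : ℕ} {f g : ℝ → V → ℂ} (hf : ModB N f) (hg : ModB N g) :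
    ModB N (fun δ s => f δ s + g δ s) := by
  obtain ⟨C, k, δ₀, hC, h0, h01, hb⟩ := hf
  obtain ⟨C', k', δ₀', hC', h0', h01', hb'⟩ := hg
  refine ⟨C + C', k + k', min δ₀ δ₀', by positivity, lt_min h0 h0', (min_le_left _ _).trans h01, fun δ hδ hδ' s => ?_⟩
  have h1 : (1:ℝ) ≤ 1 + ‖s‖ := by linarith [norm_nonneg s]
  have a := hb δ hδ (hδ'.trans_le (min_le_left _ _)) s
  have b := hb' δ hδ (hδ'.trans_le (min_le_right _ _)) s
  calc ‖f δ s + g δ s‖ ≤ C * (1 + ‖s‖) ^ k * δ ^ N + C' * (1 + ‖s‖) ^ k' * δ ^ N :=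
        (norm_add_le _ _).trans (add_le_add a b)
    _ ≤ C * (1 + ‖s‖) ^ (k + k') * δ ^ N + C' * (1 + ‖s‖) ^ (k + k') * δ ^ N := by
        gcongr <;> first | exact h1 | omega
    _ = _ := by ring

theorem ModB.mul {N M : ℕ} {f g : ℝ → V → ℂ} (hf : ModB N f) (hg : ModB M g) :
    ModB (N + M) (fun δ s => f δ s * g δ s) := by
  obtain ⟨C, k, δ₀, hC, h0, h01, hb⟩ := hf
  obtain ⟨C', k', δ₀', hC', h0', h01', hb'⟩ := hg
  refine ⟨C * C', k + k', min δ₀ δ₀', by positivity, lt_min h0 h0', (min_le_left _ _).trans h01, fun δ hδ hδ' s => ?_⟩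
  have a := hb δ hδ (hδ'.trans_le (min_le_left _ _)) s
  have b := hb' δ hδ (hδ'.trans_le (min_le_right _ _)) s
  rw [norm_mul]
  calc _ ≤ (C * (1 + ‖s‖) ^ k * δ ^ N) * (C' * (1 + ‖s‖) ^ k' * δ ^ M) := by gcongr
    _ = _ := by ring

theorem ModB.pow {f : ℝ → V → ℂ} (hf : ModB 1 f) (n : ℕ) : ModB n (fun δ s => f δ s ^ n) := by
  induction n with
  | zero => exact ⟨1, 0, 1, zero_le_one, one_pos, le_rfl, by simp⟩
  | succ n ih => simpa [pow_succ] using ih.mul hf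

theorem ModB.of_SR (c : SR V) : ModB 0 (fun _ s => (c : V → ℂ) s) := by
  obtain ⟨_, C, k, hC, h⟩ := c.2
  exact ⟨C, k, 1, hC, one_pos, le_rfl, fun δ _ _ s => by simpa using h s⟩

theorem ModB.delta : ModB 1 (fun (δ : ℝ) (_ : V) => (δ : ℂ)) :=
  ⟨1, 0, 1, zero_le_one, one_pos, le_rfl, fun δ h _ s => by simp [abs_of_pos h]⟩

theorem ModB.ev (p : Polynomial (SR V)) : ModB 0 (fun δ s => ev (δ : ℂ) s p) := by
  induction p using Polynomial.induction_on with
  | C a => simpa [ev_C] using ModB.of_SR a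
  | add p q hp hq => simpa using hp.add hq
  | monomial n a h =>
    have := ((h.mul ModB.delta).mono (Nat.zero_le _))
    refine this.congr one_pos ?_
    intro δ _ _ s
    simp [pow_succ, ev_X, ev_C, mul_assoc]

def Asy (N : ℕ) (f : ℝ → V → ℂ) (a : V → ℂ) : Prop :=
  ∃ p : Polynomial (SR V), (∀ (δ : ℂ) (s : V), ev (-δ) (-s) p = ev δ s p) ∧
    (∀ s, (p.coeff 0 : V → ℂ) s = a s) ∧ ModB N (fun δ s => f δ s - ev (δ : ℂ) s p)

theorem Asy.congr {N : ℕ} {f g : ℝ → V → ℂ} {a b : V → ℂ} (hf : Asy N f a) {δ₁ : ℝ} (h1 : 0 < δ₁)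
    (h : ∀ δ, 0 < δ → δ < δ₁ → ∀ s, g δ s = f δ s) (hab : ∀ s, a s = b s) : Asy N g b := by
  obtain ⟨p, h2, h3, h4⟩ := hf
  refine ⟨p, h2, fun s => (h3 s).trans (hab s), h4.congr h1 ?_⟩
  intro δ hδ hδ' s
  rw [h δ hδ hδ' s]

theorem Asy.add_mod {N : ℕ} {f g : ℝ → V → ℂ} {a : V → ℂ} (hf : Asy N f a) (hg : ModB N g) :
    Asy N (fun δ s => f δ s + g δ s) a := by
  obtain ⟨p, h2, h3, h4⟩ := hf
  refine ⟨p, h2, h3, (h4.add hg).congr one_pos ?_⟩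
  intro δ _ _ s
  rw [sub_add_eq_add_sub]

theorem Asy.modB {N : ℕ} {f : ℝ → V → ℂ} {a : V → ℂ} (hf : Asy N f a) : ModB 0 f := by
  obtain ⟨p, h2, h3, h4⟩ := hf
  refine ((h4.mono (Nat.zero_le _)).add (ModB.ev p)).congr one_pos ?_
  intro δ _ _ s
  simp

theorem Asy.add {N : ℕ} {f g : ℝ → V → ℂ} {a b : V → ℂ} (hf : Asy N f a) (hg : Asy N g b) :
    Asy N (fun δ s => f δ s + g δ s) (fun s => a s + b s) := by
  obtain ⟨p, h2, h3, h4⟩ := hf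
  obtain ⟨p', h2', h3', h4'⟩ := hg
  refine ⟨p + p', fun δ s => by simp [h2, h2'], fun s => by simp [h3, h3'], (h4.add h4').congr one_pos ?_⟩
  intro δ _ _ s
  apply le_of_eq
  congr 1
  rw [map_add]; ring

theorem Asy.mul {N : ℕ} {f g : ℝ → V → ℂ} {a b : V → ℂ} (hf : Asy N f a) (hg : Asy N g b) :
    Asy N (fun δ s => f δ s * g δ s) (fun s => a s * b s) := by
  have hgm := hg.modB
  obtain ⟨p, h2, h3, h4⟩ := hf
  obtain ⟨p', h2', h3', h4'⟩ := hg
  refine ⟨p * p', fun δ s => by simp [h2, h2'], fun s => by simp [Polynomial.mul_coeff_zero, h3, h3'], ?_⟩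
  have e1 := h4.mul hgm
  have e2 := (ModB.ev p).mul h4'
  rw [zero_add] at e2
  refine (e1.add e2).congr one_pos ?_
  intro δ _ _ s
  apply le_of_eq
  congr 1
  rw [map_mul]; ring

theorem Asy.of_SR (N : ℕ) (c : SR V) (hc : ∀ s, (c : V → ℂ) (-s) = (c : V → ℂ) s) :
    Asy N (fun _ s => (c : V → ℂ) s) (fun s => (c : V → ℂ) s) := by
  refine ⟨Polynomial.C c, fun δ s => by simp [ev_C, hc], by simp, ?_⟩
  refine ⟨0, 0, 1, le_rfl, one_pos, le_rfl, ?_⟩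
  simp [ev_C]

theorem SR_const_mem (c : ℂ) : (fun _ : V => c) ∈ SR V :=
  ⟨continuous_const, ‖c‖, 0, norm_nonneg _, by simp⟩

theorem Asy.const (N : ℕ) (c : ℂ) : Asy N (fun _ (_ : V) => c) (fun _ => c) :=
  Asy.of_SR N ⟨_, SR_const_mem c⟩ (fun _ => rfl)

theorem Asy.pow {N : ℕ} {f : ℝ → V → ℂ} {a : V → ℂ} (hf : Asy N f a) (n : ℕ) :
    Asy N (fun δ s => f δ s ^ n) (fun s => a s ^ n) := by
  induction n with
  | zero => simpa using Asy.const N 1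
  | succ n ih => simpa [pow_succ] using ih.mul hf

theorem Asy.sum {ι : Type*} {N : ℕ} {f : ι → ℝ → V → ℂ} {a : ι → V → ℂ} (t : Finset ι)
    (hf : ∀ i ∈ t, Asy N (f i) (a i)) :
    Asy N (fun δ s => ∑ i ∈ t, f i δ s) (fun s => ∑ i ∈ t, a i s) := by
  classical
  induction t using Finset.induction_on with
  | empty => simpa using Asy.const N 0
  | insert i t hi ih =>
    simp only [Finset.sum_insert hi]
    exact (hf i (by simp)).add (ih fun j hj => hf j (by simp [hj]))

theorem Asy.prod {ι : Type*} {N : ℕ} {f : ι → ℝ → V → ℂ} {a : ι → V → ℂ} (t : Finset ι)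
    (hf : ∀ i ∈ t, Asy N (f i) (a i)) :
    Asy N (fun δ s => ∏ i ∈ t, f i δ s) (fun s => ∏ i ∈ t, a i s) := by
  classical
  induction t using Finset.induction_on with
  | empty => simpa using Asy.const N 1
  | insert i t hi ih =>
    simp only [Finset.prod_insert hi]
    exact (hf i (by simp)).mul (ih fun j hj => hf j (by simp [hj]))

theorem Asy.exp {N : ℕ} (hN : 1 ≤ N) {f : ℝ → V → ℂ} {a : V → ℂ} (hf : Asy N f a) {K δ₁ : ℝ} (h1 : 0 < δ₁)
    (hK : ∀ δ, 0 < δ → δ < δ₁ → ∀ s, (f δ s).re ≤ K) (ha : ∀ s, (a s).re ≤ K) :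
    Asy N (fun δ s => Complex.exp (f δ s)) (fun s => Complex.exp (a s)) := by
  obtain ⟨p, h2, h3, h4⟩ := hf
  have heven : ∀ s, a (-s) = a s := by
    intro s
    rw [← h3, ← h3, ← ev_zero, ← ev_zero, ← h2 0 s, neg_zero]
  have hcoe : ((p.coeff 0 : SR V) : V → ℂ) = a := funext h3
  have hη : Asy N (fun δ s => f δ s - a s) (fun _ => 0) := by
    refine ⟨p - Polynomial.C (p.coeff 0), ?_, ?_, ?_⟩
    · intro δ s
      rw [map_sub, map_sub, ev_C, ev_C, h2, h3, h3, heven]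
    · intro s; simp
    · refine h4.congr one_pos ?_
      intro δ _ _ s
      apply le_of_eq
      congr 1
      rw [map_sub, ev_C, h3]; ring
  have hη1 : ModB 1 (fun δ s => f δ s - a s) := by
    have e := (ModB.ev p.divX).mul ModB.delta
    rw [zero_add] at e
    refine ((h4.mono hN).add e).congr one_pos ?_
    intro δ _ _ s
    apply le_of_eq
    congr 1
    have : _root_.ev (δ:ℂ) s p = _root_.ev (δ:ℂ) s p.divX * δ + a s := by
      conv_lhs => rw [← Polynomial.divX_mul_X_add p]
      rw [map_add, map_mul, ev_X, ev_C, h3]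
    rw [this]; ring
  have hexpS : (fun s => Complex.exp (a s)) ∈ SR V := by
    refine ⟨?_, Real.exp K, 0, (Real.exp_pos _).le, ?_⟩
    · rw [← hcoe]; exact (p.coeff 0).2.1.cexp
    · intro s
      rw [Complex.norm_exp]; simpa using ha s
  have hA := Asy.of_SR N ⟨_, hexpS⟩ (fun s => by simp [heven])
  have hsum := Asy.sum (Finset.range N) (fun k _ =>
    (Asy.const (V := V) N (1 / (k.factorial : ℂ))).mul (hη.pow k))
  have hrem : ModB N (fun δ s => Complex.exp (a s) * (Complex.exp (f δ s - a s) -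
      ∑ k ∈ Finset.range N, (f δ s - a s) ^ k / (k.factorial : ℂ))) := by
    have e := (ModB.of_SR (⟨_, SR_const_mem (Real.exp K : ℂ)⟩ : SR V)).mul (hη1.pow N)
    rw [zero_add] at e
    refine e.congr h1 ?_
    intro δ hδ hδ' s
    rw [norm_mul, norm_mul, norm_pow]
    have hr := exp_rem_s4 N (f δ s - a s)
    have hnr : ‖(Real.exp K : ℂ)‖ = Real.exp K := by
      rw [Complex.norm_real, Real.norm_of_nonneg (Real.exp_pos _).le]
    change _ ≤ ‖(Real.exp K : ℂ)‖ * _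
    rw [hnr]
    calc _ ≤ ‖Complex.exp (a s)‖ * (‖f δ s - a s‖ ^ N * max 1 (Real.exp (f δ s - a s).re)) := by gcongr
      _ = (Real.exp (a s).re * max 1 (Real.exp (f δ s - a s).re)) * ‖f δ s - a s‖ ^ N := by
        rw [Complex.norm_exp]; ring
      _ ≤ _ := by
        gcongr
        rw [mul_max_of_nonneg _ _ (Real.exp_pos _).le, mul_one, ← Real.exp_add]
        apply max_le
        · exact Real.exp_le_exp.2 (ha s)
        · apply Real.exp_le_exp.2
          have := hK δ hδ hδ' s
          simpa using this
  refine ((hA.mul hsum).add_mod hrem).congr one_pos ?_ ?_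
  · intro δ _ _ s
    have : Complex.exp (f δ s) = Complex.exp (a s) * Complex.exp (f δ s - a s) := by
      rw [← Complex.exp_add]; ring_nf
    rw [this]
    simp only [div_eq_inv_mul]
    ring_nf
  · intro s
    obtain ⟨M, rfl⟩ := Nat.exists_eq_add_of_le' hN
    simp [Finset.sum_range_succ']

open MeasureTheory in
theorem Asy.integral [MeasurableSpace V] [BorelSpace V] [SecondCountableTopology V] (μ : Measure V)
    (hmom : ∀ k : ℕ, Integrable (fun s : V => (1 + ‖s‖) ^ k) μ)
    (hsym : ∀ h : V → ℂ, ∫ s, h (-s) ∂μ = ∫ s, h s ∂μ)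
    {N : ℕ} {f : ℝ → V → ℂ} {a : V → ℂ} (hf : Asy N f a) {δ₁ : ℝ} (h1 : 0 < δ₁)
    (hInt : ∀ δ, 0 < δ → δ < δ₁ → Integrable (f δ) μ) :
    ∃ P : Polynomial ℂ, P.comp (-Polynomial.X) = P ∧ P.coeff 0 = ∫ s, a s ∂μ ∧
      ∃ C δ₀ : ℝ, 0 < δ₀ ∧ ∀ δ, 0 < δ → δ < δ₀ → ‖∫ s, f δ s ∂μ - P.eval (δ:ℂ)‖ ≤ C * δ ^ N := by
  obtain ⟨p, h2, h3, h4⟩ := hf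
  have hSR : ∀ c : SR V, Integrable (c : V → ℂ) μ := by
    intro c
    obtain ⟨hc, C, k, hC, h⟩ := c.2
    refine Integrable.mono' ((hmom k).const_mul C) hc.aestronglyMeasurable ?_
    exact Filter.Eventually.of_forall h
  set P : Polynomial ℂ := ∑ n ∈ Finset.range (p.natDegree + 1),
    Polynomial.monomial n (∫ s, (p.coeff n : V → ℂ) s ∂μ) with hP
  have hPe : ∀ δ : ℂ, P.eval δ = ∫ s, ev δ s p ∂μ := by
    intro δ
    simp only [ev_sum]
    rw [integral_finsetSum _ (fun n _ => (hSR _).mul_const _), hP, Polynomial.eval_finsetSum]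
    apply Finset.sum_congr rfl
    intro n _
    rw [Polynomial.eval_monomial, integral_mul_const]
  have hevint : ∀ δ : ℂ, Integrable (fun s => ev δ s p) μ := by
    intro δ
    simp only [ev_sum]
    exact integrable_finsetSum _ (fun n _ => (hSR _).mul_const _)
  refine ⟨P, ?_, ?_, ?_⟩
  · apply Polynomial.funext
    intro δ
    rw [Polynomial.eval_comp, Polynomial.eval_neg, Polynomial.eval_X, hPe, hPe, ← hsym]
    simp only [h2]
  · rw [Polynomial.coeff_zero_eq_eval_zero, hPe]
    simp only [ev_zero, h3]
  · obtain ⟨C, k, δ₀, hC, h0, h01, hb⟩ := h4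
    refine ⟨C * ∫ s, (1 + ‖s‖) ^ k ∂μ, min δ₀ δ₁, lt_min h0 h1, fun δ hδ hδ' => ?_⟩
    rw [hPe, ← integral_sub (hInt δ hδ (hδ'.trans_le (min_le_right _ _))) (hevint _)]
    have hi : Integrable (fun s : V => C * (1 + ‖s‖) ^ k * δ ^ N) μ := ((hmom k).const_mul C).mul_const _
    refine (norm_integral_le_of_norm_le hi
      (Filter.Eventually.of_forall (hb δ hδ (hδ'.trans_le (min_le_left _ _))))).trans ?_
    rw [integral_mul_const, integral_const_mul]

end AsyClass

theorem rho_exists (z c : ℝ) (hz : 0 < z) (hz1 : z < 1) (hc : 0 < c) :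
    ∃ ρ δ₁ : ℝ, 0 < ρ ∧ ρ < 1 ∧ 0 < δ₁ ∧ δ₁ ≤ 1 ∧ ∀ δ, 0 < δ → δ < δ₁ →
      z * Real.exp (c * δ ^ 2) ≤ ρ := by
  refine ⟨(1 + z) / 2, min 1 (Real.log ((1 + z) / 2 / z) / c), by linarith, by linarith, ?_, min_le_left _ _, ?_⟩
  · refine lt_min one_pos (div_pos (Real.log_pos ?_) hc)
    rw [lt_div_iff₀ hz]; linarith
  · intro δ h0 h1
    have h2 : δ < 1 := h1.trans_le (min_le_left _ _)
    have h3 := h1.trans_le (min_le_right _ _)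
    rw [lt_div_iff₀ hc] at h3
    have h4 : c * δ ^ 2 ≤ Real.log ((1 + z) / 2 / z) := by
      nlinarith [mul_pos hc h0]
    have h5 : Real.exp (c * δ ^ 2) ≤ (1 + z) / 2 / z := by
      rw [← Real.le_log_iff_exp_le (by positivity)]; exact h4
    calc z * Real.exp (c * δ ^ 2) ≤ z * ((1 + z) / 2 / z) := by gcongr
      _ = _ := by field_simp

theorem rho_pow {z c ρ δ : ℝ} (hz : 0 < z) (h : z * Real.exp (c * δ ^ 2) ≤ ρ) (k : ℕ) :
    z ^ (k + 1) * Real.exp (c * (δ ^ 2 * ((k:ℝ) + 1))) ≤ ρ ^ (k + 1) := by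
  have : Real.exp (c * (δ ^ 2 * ((k:ℝ) + 1))) = Real.exp (c * δ ^ 2) ^ (k + 1) := by
    rw [← Real.exp_nat_mul]; congr 1; push_cast; ring
  rw [this, ← mul_pow]
  gcongr

theorem summable_poly_geo (ρ : ℝ) (h0 : 0 < ρ) (h1 : ρ < 1) (d : ℕ) :
    Summable (fun k : ℕ => ρ ^ (k + 1) * ((k:ℝ) + 1) ^ d) := by
  have := summable_pow_mul_geometric_of_norm_lt_one d (r := ρ) (by rwa [Real.norm_of_nonneg h0.le])
  have := (summable_nat_add_iff 1).2 this
  refine this.congr fun k => ?_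
  push_cast; ring

theorem summable_K (z : ℝ) (h0 : 0 < z) (h1 : z < 1) (d : ℕ) :
    Summable (fun k : ℕ => z ^ (k + 1) / ((k:ℝ) + 1) ^ 2 * ((k:ℝ) + 1) ^ d) := by
  refine Summable.of_nonneg_of_le (fun k => by positivity) (fun k => ?_) (summable_poly_geo z h0 h1 d)
  gcongr
  apply div_le_self (by positivity)
  exact one_le_pow₀ (by linarith [(Nat.cast_nonneg k : (0:ℝ) ≤ k)])

/-- Summand of the phase function. -/
noncomputable def phiT (B z δ x : ℝ) (k : ℕ) : ℂ :=
  ((z ^ (k + 1) / ((k:ℝ) + 1) ^ 2 / δ ^ 2 : ℝ) : ℂ) *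
    (Complex.exp (((((k:ℝ) + 1) * δ * x : ℝ) : ℂ) * Complex.I) * (gB B (δ ^ 2 * ((k:ℝ) + 1)) : ℂ)
      - 1 - ((((k:ℝ) + 1) * δ * x : ℝ) : ℂ) * Complex.I)

/-- Polynomial approximation of the phase summand. -/
noncomputable def phiM (g : ℕ → ℝ) (M : ℕ) (z δ x : ℝ) (k : ℕ) : ℂ :=
  ∑ p ∈ (Finset.range M ×ˢ Finset.range M).filter (fun p => 2 ≤ p.1 + 2 * p.2),
    ((z ^ (k + 1) / ((k:ℝ) + 1) ^ 2 * ((k:ℝ) + 1) ^ (p.1 + p.2) : ℝ) : ℂ) *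
      (((x : ℂ) * Complex.I) ^ p.1 / (p.1.factorial : ℂ) * (g p.2 : ℂ) * (δ : ℂ) ^ (p.1 + 2 * p.2 - 2))

theorem phi_err (B : ℝ) (g : ℕ → ℝ) (hg0 : g 0 = 1) (N : ℕ) (C : ℝ) (hC : 0 ≤ C)
    (hg : ∀ y, 0 < y → |gB B y - ∑ m ∈ Finset.range (N + 2), g m * y ^ m|
      ≤ C * y ^ (N + 2) * Real.exp ((|B| + 1) * y))
    {z δ ρ : ℝ} (hz : 0 < z) (hρ : z * Real.exp ((|B| + 1) * δ ^ 2) ≤ ρ) (hδ : 0 < δ) (hδ1 : δ < 1)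
    (x : ℝ) (k : ℕ) :
    ‖phiT B z δ x k - phiM g (N + 2) z δ x k‖ ≤
      (C + ∑ m ∈ Finset.range (N + 2), |g m|) * (1 + |x|) ^ (N + 2) * δ ^ N *
        (ρ ^ (k + 1) * ((k:ℝ) + 1) ^ (2 * (N + 2))) := by
  set M := N + 2 with hM
  set Γ := ∑ m ∈ Finset.range M, |g m| with hΓ
  have hΓ0 : 0 ≤ Γ := Finset.sum_nonneg fun _ _ => abs_nonneg _
  set κ : ℝ := (k:ℝ) + 1 with hκ
  have hκ1 : 1 ≤ κ := by rw [hκ]; linarith [(Nat.cast_nonneg k : (0:ℝ) ≤ k)]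
  set w : ℂ := ((κ * δ * x : ℝ) : ℂ) * Complex.I with hw
  set y : ℝ := δ ^ 2 * κ with hy
  have hy0 : 0 < y := by positivity
  set E : ℂ := ∑ n ∈ Finset.range M, w ^ n / (n.factorial : ℂ) with hE
  set G : ℝ := ∑ m ∈ Finset.range M, g m * y ^ m with hG
  have hd2 : (δ : ℂ) ≠ 0 := by exact_mod_cast hδ.ne'
  have hk2 : (κ : ℂ) ≠ 0 := by
    have : κ ≠ 0 := by positivity
    exact_mod_cast this
  -- main term
  have hmain : phiM g M z δ x k = ((z ^ (k + 1) / κ ^ 2 / δ ^ 2 : ℝ) : ℂ) * (E * (G : ℂ) - 1 - w) := by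
    have e1 : E * (G : ℂ) = ∑ p ∈ Finset.range M ×ˢ Finset.range M,
        (w ^ p.1 / (p.1.factorial : ℂ)) * ((g p.2 * y ^ p.2 : ℝ) : ℂ) := by
      rw [hE, hG, Complex.ofReal_sum, Finset.sum_mul_sum, Finset.sum_product]
    have e2 : ∑ p ∈ (Finset.range M ×ˢ Finset.range M).filter (fun p => ¬ 2 ≤ p.1 + 2 * p.2),
        (w ^ p.1 / (p.1.factorial : ℂ)) * ((g p.2 * y ^ p.2 : ℝ) : ℂ) = 1 + w := by
      have : (Finset.range M ×ˢ Finset.range M).filter (fun p => ¬ 2 ≤ p.1 + 2 * p.2)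
          = {(0, 0), (1, 0)} := by
        ext ⟨a, b⟩
        simp only [Finset.mem_filter, Finset.mem_product, Finset.mem_range, Finset.mem_insert,
          Finset.mem_singleton, Prod.mk.injEq]
        omega
      rw [this, Finset.sum_pair (by simp)]
      simp [hg0]
    have e3 := Finset.sum_filter_add_sum_filter_not (Finset.range M ×ˢ Finset.range M)
      (fun p => 2 ≤ p.1 + 2 * p.2) (fun p => (w ^ p.1 / (p.1.factorial : ℂ)) * ((g p.2 * y ^ p.2 : ℝ) : ℂ))
    rw [e2, ← e1] at e3
    have e4 : E * (G : ℂ) - 1 - w = ∑ p ∈ (Finset.range M ×ˢ Finset.range M).filter (fun p => 2 ≤ p.1 + 2 * p.2),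
        (w ^ p.1 / (p.1.factorial : ℂ)) * ((g p.2 * y ^ p.2 : ℝ) : ℂ) := by
      rw [← e3]; ring
    rw [e4, Finset.mul_sum, phiM]
    apply Finset.sum_congr rfl
    rintro ⟨n, m⟩ hp
    simp only [Finset.mem_filter] at hp
    obtain ⟨t, ht⟩ := Nat.exists_eq_add_of_le hp.2
    have ht' : n + 2 * m - 2 = t := by omega
    simp only [ht']
    have hdd : (δ : ℂ) ^ t * (δ : ℂ) ^ 2 = (δ : ℂ) ^ n * ((δ : ℂ) ^ 2) ^ m := by
      rw [← pow_mul, ← pow_add, ← pow_add]; congr 1; omega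
    rw [hw, hy]
    have hκc : (k:ℂ) + 1 = (κ:ℂ) := by rw [hκ]; push_cast; rfl
    push_cast
    rw [hκc]
    have hf : (n.factorial : ℂ) ≠ 0 := by exact_mod_cast n.factorial_ne_zero
    rw [← mul_right_inj' (pow_ne_zero 2 hd2)]
    field_simp
    calc _ = (z:ℂ) ^ (k + 1) * (κ:ℂ) ^ (n + m) * x ^ n * Complex.I ^ n * g m * ((δ : ℂ) ^ t * (δ : ℂ) ^ 2) := by ring
      _ = _ := by rw [hdd]; ring
  have hT : phiT B z δ x k = ((z ^ (k + 1) / κ ^ 2 / δ ^ 2 : ℝ) : ℂ) *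
      (Complex.exp w * (gB B y : ℂ) - 1 - w) := rfl
  have hexp : ‖Complex.exp w - E‖ ≤ |κ * δ * x| ^ M := by
    have := exp_rem_s4 M w
    have hre : w.re = 0 := by simp [hw]
    have hn : ‖w‖ = |κ * δ * x| := by rw [hw, norm_mul, Complex.norm_I, mul_one, Complex.norm_real, Real.norm_eq_abs]
    rw [hre, Real.exp_zero, max_self, mul_one, hn] at this
    exact this
  have hnexp : ‖Complex.exp w‖ = 1 := by rw [hw]; exact Complex.norm_exp_ofReal_mul_I _
  have hGb : |G| ≤ Γ * κ ^ M := by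
    rw [hG, hΓ, Finset.sum_mul]
    refine (Finset.abs_sum_le_sum_abs _ _).trans (Finset.sum_le_sum fun m hm => ?_)
    rw [abs_mul, abs_of_pos (pow_pos hy0 m)]
    gcongr
    have : y ≤ κ := by
      rw [hy]
      exact mul_le_of_le_one_left (by linarith) (pow_le_one₀ hδ.le hδ1.le)
    calc y ^ m ≤ κ ^ m := by gcongr
      _ ≤ κ ^ M := pow_le_pow_right₀ hκ1 (Finset.mem_range.1 hm).le
  have hex1 : 1 ≤ Real.exp ((|B| + 1) * y) := Real.one_le_exp (by positivity)
  have hbr : ‖Complex.exp w * (gB B y : ℂ) - E * (G : ℂ)‖ ≤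
      (C + Γ) * (1 + |x|) ^ M * (δ ^ M * κ ^ (2 * M)) * Real.exp ((|B| + 1) * y) := by
    have e : Complex.exp w * (gB B y : ℂ) - E * (G : ℂ) =
        Complex.exp w * ((gB B y - G : ℝ) : ℂ) + (Complex.exp w - E) * (G : ℂ) := by
      push_cast; ring
    rw [e]
    refine (norm_add_le _ _).trans ?_
    rw [norm_mul, norm_mul, hnexp, one_mul, Complex.norm_real, Complex.norm_real, Real.norm_eq_abs,
      Real.norm_eq_abs]
    have hx1 : (1:ℝ) ≤ (1 + |x|) ^ M := one_le_pow₀ (by linarith [abs_nonneg x])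
    have b1 : |gB B y - G| ≤ C * (1 + |x|) ^ M * (δ ^ M * κ ^ (2 * M)) * Real.exp ((|B| + 1) * y) := by
      refine (hg y hy0).trans ?_
      gcongr ?_ * _
      have : y ^ M ≤ δ ^ M * κ ^ (2 * M) := by
        rw [hy, mul_pow, ← pow_mul]
        have : δ ^ (2 * M) ≤ δ ^ M := pow_le_pow_of_le_one hδ.le hδ1.le (by omega)
        have : κ ^ M ≤ κ ^ (2 * M) := pow_le_pow_right₀ hκ1 (by omega)
        gcongr
      calc C * y ^ M ≤ C * 1 * (δ ^ M * κ ^ (2 * M)) := by rw [mul_one]; gcongr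
        _ ≤ _ := by gcongr
    have b2 : ‖Complex.exp w - E‖ * |G| ≤ Γ * (1 + |x|) ^ M * (δ ^ M * κ ^ (2 * M)) * Real.exp ((|B| + 1) * y) := by
      have hxx : |x| ^ M ≤ (1 + |x|) ^ M := by gcongr; linarith
      calc ‖Complex.exp w - E‖ * |G| ≤ |κ * δ * x| ^ M * (Γ * κ ^ M) := by gcongr
        _ = Γ * |x| ^ M * (δ ^ M * κ ^ (2 * M)) * 1 := by
          rw [abs_mul, abs_of_pos (by positivity : 0 < κ * δ)]; ring
        _ ≤ _ := by gcongr
    calc _ ≤ _ := add_le_add b1 b2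
      _ = _ := by ring
  rw [hT, hmain, ← mul_sub]
  have e5 : Complex.exp w * (gB B y : ℂ) - 1 - w - (E * (G : ℂ) - 1 - w) =
    Complex.exp w * (gB B y : ℂ) - E * (G : ℂ) := by ring
  rw [e5, norm_mul, Complex.norm_real, Real.norm_of_nonneg (by positivity)]
  have hrp := rho_pow hz hρ k
  rw [← hκ, ← hy] at hrp
  calc z ^ (k + 1) / κ ^ 2 / δ ^ 2 * ‖Complex.exp w * (gB B y : ℂ) - E * (G : ℂ)‖
      ≤ z ^ (k + 1) / 1 / δ ^ 2 * ((C + Γ) * (1 + |x|) ^ M * (δ ^ M * κ ^ (2 * M)) * Real.exp ((|B| + 1) * y)) := by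
        gcongr
        exact one_le_pow₀ hκ1
    _ = (C + Γ) * (1 + |x|) ^ M * δ ^ N * ((z ^ (k + 1) * Real.exp ((|B| + 1) * y)) * κ ^ (2 * M)) := by
        rw [hM, pow_add δ N 2]; field_simp
    _ ≤ _ := by gcongr

/-- The phase function. -/
noncomputable def Phi (B z δ x : ℝ) : ℂ := ∑' k, phiT B z δ x k

theorem phiM_hasSum (g : ℕ → ℝ) (M : ℕ) {z : ℝ} (hz : 0 < z) (hz1 : z < 1) (δ x : ℝ) :
    HasSum (phiM g M z δ x)
      (∑ p ∈ (Finset.range M ×ˢ Finset.range M).filter (fun p => 2 ≤ p.1 + 2 * p.2),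
        ((∑' k : ℕ, z ^ (k + 1) / ((k:ℝ) + 1) ^ 2 * ((k:ℝ) + 1) ^ (p.1 + p.2) : ℝ) : ℂ) *
      (((x : ℂ) * Complex.I) ^ p.1 / (p.1.factorial : ℂ) * (g p.2 : ℂ) * (δ : ℂ) ^ (p.1 + 2 * p.2 - 2))) := by
  unfold phiM
  apply hasSum_sum
  intro p _
  apply HasSum.mul_right
  exact Complex.hasSum_ofReal.2 (summable_K z hz hz1 _).hasSum

theorem phiT_summable (B : ℝ) {z δ ρ : ℝ} (hz : 0 < z) (hz1 : z < 1) (hρ0 : 0 < ρ) (hρ1 : ρ < 1)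
    (hρ : z * Real.exp ((|B| + 1) * δ ^ 2) ≤ ρ) (hδ : 0 < δ) (hδ1 : δ < 1) (x : ℝ) :
    Summable (phiT B z δ x) := by
  obtain ⟨g, hg0, hg1, hg⟩ := gB_expansion B
  obtain ⟨C, hC, hg⟩ := hg (0 + 2)
  have h := phi_err B g hg0 0 C hC hg hz hρ hδ hδ1 x
  have h1 : Summable (fun k => phiT B z δ x k - phiM g (0 + 2) z δ x k) :=
    Summable.of_norm_bounded ((summable_poly_geo ρ hρ0 hρ1 _).mul_left _) h
  refine (h1.add (phiM_hasSum g (0 + 2) hz hz1 δ x).summable).congr fun k => by simp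

theorem Phi_re_le (B : ℝ) {z ρ : ℝ} (hz : 0 < z) (hz1 : z < 1) (hρ0 : 0 < ρ) (hρ1 : ρ < 1) :
    ∃ K : ℝ, ∀ δ, z * Real.exp ((|B| + 1) * δ ^ 2) ≤ ρ → 0 < δ → δ < 1 → ∀ x, (Phi B z δ x).re ≤ K := by
  obtain ⟨g, hg0, hg1, hg⟩ := gB_expansion B
  obtain ⟨C, hC, hg⟩ := hg 1
  have hgeo := summable_poly_geo ρ hρ0 hρ1 0
  refine ⟨∑' k : ℕ, C * (ρ ^ (k + 1) * ((k:ℝ) + 1) ^ 0), fun δ hρ hδ hδ1 x => ?_⟩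
  have hs := phiT_summable B hz hz1 hρ0 hρ1 hρ hδ hδ1 x
  rw [Phi, Complex.re_tsum hs]
  refine Summable.tsum_le_tsum (fun k => ?_) (Complex.hasSum_re hs.hasSum).summable (hgeo.mul_left C)
  set κ : ℝ := (k:ℝ) + 1 with hκ
  have hκ1 : 1 ≤ κ := by rw [hκ]; linarith [(Nat.cast_nonneg k : (0:ℝ) ≤ k)]
  have hy0 : 0 < δ ^ 2 * κ := by positivity
  have hre : (phiT B z δ x k).re = z ^ (k + 1) / κ ^ 2 / δ ^ 2 *
      (Real.cos (κ * δ * x) * gB B (δ ^ 2 * κ) - 1) := by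
    rw [phiT, Complex.re_ofReal_mul, Complex.sub_re, Complex.sub_re, Complex.re_mul_ofReal,
      Complex.exp_ofReal_mul_I_re]
    simp [hκ]
  have hgp := gB_pos B hy0
  have hc := Real.cos_le_one (κ * δ * x)
  have h1 := hg _ hy0
  simp only [Finset.sum_range_one, hg0, pow_zero, mul_one, pow_one] at h1
  have h2 := (le_abs_self _).trans h1
  have hrp := rho_pow hz hρ k
  rw [← hκ] at hrp
  rw [hre, pow_zero, mul_one]
  calc z ^ (k + 1) / κ ^ 2 / δ ^ 2 * (Real.cos (κ * δ * x) * gB B (δ ^ 2 * κ) - 1)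
      ≤ z ^ (k + 1) / κ ^ 2 / δ ^ 2 * (C * (δ ^ 2 * κ) * Real.exp ((|B| + 1) * (δ ^ 2 * κ))) := by
        gcongr
        nlinarith
    _ = C * (z ^ (k + 1) * Real.exp ((|B| + 1) * (δ ^ 2 * κ))) / κ := by field_simp
    _ ≤ C * (z ^ (k + 1) * Real.exp ((|B| + 1) * (δ ^ 2 * κ))) := div_le_self (by positivity) hκ1
    _ ≤ C * ρ ^ (k + 1) := by gcongr

theorem Asy.monomial {V : Type*} [NormedAddCommGroup V] (N d : ℕ) (c : SR V)
    (hc : ∀ s, (c : V → ℂ) (-s) = (-1) ^ d * (c : V → ℂ) s) :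
    Asy N (fun δ s => (c : V → ℂ) s * (δ : ℂ) ^ d) (fun s => if d = 0 then (c : V → ℂ) s else 0) := by
  refine ⟨Polynomial.C c * Polynomial.X ^ d, fun δ s => ?_, fun s => ?_, ?_⟩
  · simp only [map_mul, map_pow, ev_C, ev_X, hc]
    rw [neg_pow δ]
    have : ((-1:ℂ) ^ d) * (-1) ^ d = 1 := by rw [← mul_pow]; simp
    linear_combination ((c : V → ℂ) s * δ ^ d) * this
  · rw [Polynomial.coeff_C_mul, Polynomial.coeff_X_pow]
    by_cases hd : d = 0
    · simp [hd]
    · simp [hd, Ne.symm hd]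
  · refine ⟨0, 0, 1, le_rfl, one_pos, le_rfl, ?_⟩
    simp [ev_C, ev_X]

theorem Phi_asy {V : Type*} [NormedAddCommGroup V] [NormedSpace ℝ V] (X : V →L[ℝ] ℝ)
    (B : ℝ) {z : ℝ} (hz : 0 < z) (hz1 : z < 1) (N : ℕ) (hN : 1 ≤ N) :
    Asy N (fun δ s => Phi B z δ (X s)) (fun s =>
      ((-(X s ^ 2 / 2) * (z / (1 - z)) + (1 / 2 - B) * (-Real.log (1 - z)) : ℝ) : ℂ)) := by
  obtain ⟨g, hg0, hg1, hg⟩ := gB_expansion B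
  obtain ⟨C, hC, hg⟩ := hg (N + 2)
  obtain ⟨ρ, δ₁, hρ0, hρ1, hδ0, hδ11, hρ⟩ := rho_exists z (|B| + 1) hz hz1 (by positivity)
  set S := (Finset.range (N + 2) ×ˢ Finset.range (N + 2)).filter (fun p => 2 ≤ p.1 + 2 * p.2) with hS
  set K : ℕ → ℝ := fun d => ∑' k : ℕ, z ^ (k + 1) / ((k:ℝ) + 1) ^ 2 * ((k:ℝ) + 1) ^ d with hK
  have hmem : ∀ p : ℕ × ℕ, (fun s : V => (K (p.1 + p.2) : ℂ) *
      ((((X s : ℝ) : ℂ) * Complex.I) ^ p.1 / (p.1.factorial : ℂ) * (g p.2 : ℂ))) ∈ SR V := by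
    intro p
    refine (SR V).mul_mem (SR_const_mem _) ((SR V).mul_mem ?_ (SR_const_mem _))
    have : (fun s : V => (((X s : ℝ) : ℂ) * Complex.I) ^ p.1 / (p.1.factorial : ℂ)) =
      (fun s : V => (((X s : ℝ) : ℂ) * Complex.I)) ^ p.1 * (fun _ => ((p.1.factorial : ℂ))⁻¹) := by
      ext s; simp [div_eq_mul_inv]
    rw [this]
    refine (SR V).mul_mem ((SR V).pow_mem ⟨by fun_prop, ‖X‖, 1, norm_nonneg _, fun s => ?_⟩ _) (SR_const_mem _)
    rw [norm_mul, Complex.norm_I, mul_one, Complex.norm_real, pow_one]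
    refine (X.le_opNorm s).trans ?_
    gcongr; linarith
  have hmain := Asy.sum (N := N) S (fun p hp => Asy.monomial N (p.1 + 2 * p.2 - 2) ⟨_, hmem p⟩ (by
    intro s
    have hp2 : 2 ≤ p.1 + 2 * p.2 := (Finset.mem_filter.1 hp).2
    simp only [map_neg, Complex.ofReal_neg, neg_mul]
    rw [neg_pow]
    have : (-1 : ℂ) ^ (p.1 + 2 * p.2 - 2) = (-1) ^ p.1 := by
      obtain ⟨t, ht⟩ := Nat.exists_eq_add_of_le hp2
      have ht' : p.1 + 2 * p.2 - 2 = t := by omega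
      rw [ht']
      have : (-1 : ℂ) ^ (p.1 + 2 * p.2) = (-1) ^ (2 + t) := by rw [ht]
      rw [pow_add, pow_add, pow_mul] at this
      simpa using this.symm
    rw [this]; ring))
  have herr : ModB N (fun δ s => Phi B z δ (X s) - ∑ p ∈ S, ((K (p.1 + p.2) : ℂ) *
      ((((X s : ℝ) : ℂ) * Complex.I) ^ p.1 / (p.1.factorial : ℂ) * (g p.2 : ℂ))) * (δ:ℂ) ^ (p.1 + 2 * p.2 - 2)) := by
    have hgeo := summable_poly_geo ρ hρ0 hρ1 (2 * (N + 2))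
    set Γ := ∑ m ∈ Finset.range (N + 2), |g m|
    have hΓ0 : 0 ≤ Γ := Finset.sum_nonneg fun _ _ => abs_nonneg _
    set W := ∑' k : ℕ, ρ ^ (k + 1) * ((k:ℝ) + 1) ^ (2 * (N + 2))
    have hW : 0 ≤ W := tsum_nonneg fun k => by positivity
    refine ⟨(C + Γ) * (1 + ‖X‖) ^ (N + 2) * W, N + 2, δ₁, by positivity, hδ0, hδ11, fun δ h0 h1 s => ?_⟩
    have hδ1 := h1.trans_le hδ11
    have hm := phiM_hasSum g (N + 2) hz hz1 δ (X s)
    have hT := (phiT_summable B hz hz1 hρ0 hρ1 (hρ δ h0 h1) h0 hδ1 (X s)).hasSum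
    have hd := hT.sub hm
    have hb := tsum_of_norm_bounded (hgeo.hasSum.mul_left _)
      (phi_err B g hg0 N C hC hg hz (hρ δ h0 h1) h0 hδ1 (X s))
    rw [hd.tsum_eq] at hb
    have e : ∀ (u v w : ℂ), u = v → ‖w - u‖ = ‖w - v‖ := by rintro u v w rfl; rfl
    change ‖(∑' k, phiT B z δ (X s) k) - _‖ ≤ _
    rw [e _ _ _ (Finset.sum_congr rfl fun p _ => by rw [mul_assoc])]
    refine hb.trans ?_
    have hx : 1 + |X s| ≤ (1 + ‖X‖) * (1 + ‖s‖) := by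
      have := X.le_opNorm s
      rw [Real.norm_eq_abs] at this
      nlinarith [norm_nonneg X, norm_nonneg s]
    calc _ ≤ (C + Γ) * ((1 + ‖X‖) * (1 + ‖s‖)) ^ (N + 2) * δ ^ N * W := by gcongr
      _ = _ := by rw [mul_pow]; ring
  refine (hmain.add_mod herr).congr one_pos ?_ ?_
  · intro δ _ _ s
    simp
  · intro s
    have hS2 : S.filter (fun p => p.1 + 2 * p.2 - 2 = 0) = {(2, 0), (0, 1)} := by
      ext ⟨a, b⟩
      simp only [hS, Finset.mem_filter, Finset.mem_product, Finset.mem_range, Finset.mem_insert,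
          Finset.mem_singleton, Prod.mk.injEq]
      omega
    rw [← Finset.sum_filter, hS2, Finset.sum_pair (by simp)]
    have hK2 : K 2 = z / (1 - z) := by
      rw [hK]
      have := (hasSum_geometric_of_lt_one hz.le hz1).mul_left z
      rw [div_eq_mul_inv, ← this.tsum_eq]
      apply tsum_congr
      intro k
      have : (k:ℝ) + 1 ≠ 0 := by positivity
      field_simp
      ring
    have hK1 : K 1 = -Real.log (1 - z) := by
      rw [hK]
      have := Real.hasSum_pow_div_log_of_abs_lt_one (x := z) (by rwa [abs_of_pos hz])
      rw [← this.tsum_eq]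
      apply tsum_congr
      intro k
      have : (k:ℝ) + 1 ≠ 0 := by positivity
      field_simp
    simp only [hg0, hg1, hK2, hK1, add_zero, zero_add, pow_zero, Nat.factorial]
    rw [mul_pow, Complex.I_sq]
    push_cast
    ring

theorem f_eq_exp_Phi (B : ℝ) {z δ ρ : ℝ} (hz : 0 < z) (hz1 : z < 1) (hρ0 : 0 < ρ) (hρ1 : ρ < 1)
    (hρ : z * Real.exp ((|B| + 1) * δ ^ 2) ≤ ρ) (hδ : 0 < δ) (hδ1 : δ < 1) (x : ℝ) :
    Complex.exp (((Real.log (1 - z) / δ * x : ℝ) : ℂ) * Complex.I - ((dilog z / δ ^ 2 : ℝ) : ℂ)) *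
      ∑' n : ℕ, (((z * Real.exp (-(δ ^ 2 * B)) : ℝ) : ℂ) * Complex.exp (((δ * x : ℝ) : ℂ) * Complex.I)) ^ n /
        (qPoch (Real.exp (-δ ^ 2)) n : ℂ) = Complex.exp (Phi B z δ x) := by
  have hq1 : Real.exp (-δ ^ 2) < 1 := by
    rw [Real.exp_lt_one_iff]; nlinarith
  have hnorm : ‖(((z * Real.exp (-(δ ^ 2 * B)) : ℝ) : ℂ) * Complex.exp (((δ * x : ℝ) : ℂ) * Complex.I))‖ < 1 := by
    rw [norm_mul, Complex.norm_exp_ofReal_mul_I, mul_one, Complex.norm_real, Real.norm_of_nonneg (by positivity)]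
    refine lt_of_le_of_lt ?_ hρ1
    refine le_trans ?_ hρ
    gcongr
    nlinarith [neg_abs_le B, sq_nonneg δ]
  rw [euler_identity (Real.exp_pos _) hq1 hnorm, ← Complex.exp_add]
  congr 1
  have hT := (phiT_summable B hz hz1 hρ0 hρ1 hρ hδ hδ1 x).hasSum
  have hdil : HasSum (fun k : ℕ => z ^ (k + 1) / ((k:ℝ) + 1) ^ 2) (dilog z) := by
    refine Summable.hasSum ?_
    simpa using summable_K z hz hz1 0
  have hlog := Real.hasSum_pow_div_log_of_abs_lt_one (x := z) (by rwa [abs_of_pos hz])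
  have h1 := Complex.hasSum_ofReal.2 (hdil.div_const (δ ^ 2))
  have h2 := (Complex.hasSum_ofReal.2 (hlog.mul_right (x / δ))).mul_right Complex.I
  have h3 := (hT.add h1).add h2
  have hδc : (δ:ℂ) ≠ 0 := by exact_mod_cast hδ.ne'
  have h4 : ∀ k : ℕ, (((z * Real.exp (-(δ ^ 2 * B)) : ℝ) : ℂ) * Complex.exp (((δ * x : ℝ) : ℂ) * Complex.I)) ^ (k + 1)
      / (((k:ℂ) + 1) * (1 - ((Real.exp (-δ ^ 2) : ℝ) : ℂ) ^ (k + 1))) =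
      phiT B z δ x k + ((z ^ (k + 1) / ((k:ℝ) + 1) ^ 2 / δ ^ 2 : ℝ) : ℂ) +
        ((z ^ (k + 1) / ((k:ℝ) + 1) * (x / δ) : ℝ) : ℂ) * Complex.I := by
    intro k
    have hκ : ((k:ℂ) + 1) ≠ 0 := by exact_mod_cast k.succ_ne_zero
    have e1 : Complex.exp (((δ * x : ℝ) : ℂ) * Complex.I) ^ (k + 1) =
        Complex.exp (((((k:ℝ) + 1) * δ * x : ℝ) : ℂ) * Complex.I) := by
      rw [← Complex.exp_nat_mul]; congr 1; push_cast; ring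
    have e2 : Real.exp (-(δ ^ 2 * B)) ^ (k + 1) = Real.exp (-B * (δ ^ 2 * ((k:ℝ) + 1))) := by
      rw [← Real.exp_nat_mul]; congr 1; push_cast; ring
    have e3 : Real.exp (-δ ^ 2) ^ (k + 1) = Real.exp (-(δ ^ 2 * ((k:ℝ) + 1))) := by
      rw [← Real.exp_nat_mul]; congr 1; push_cast; ring
    have hne : 1 - Real.exp (-(δ ^ 2 * ((k:ℝ) + 1))) ≠ 0 := by
      have : Real.exp (-(δ ^ 2 * ((k:ℝ) + 1))) < 1 := by
        rw [Real.exp_lt_one_iff, neg_lt_zero]; positivity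
      linarith
    have hne' : (1:ℂ) - ((Real.exp (-(δ ^ 2 * ((k:ℝ) + 1))) : ℝ) : ℂ) ≠ 0 := by exact_mod_cast hne
    rw [mul_pow, e1, ← Complex.ofReal_pow, mul_pow, e2, ← Complex.ofReal_pow, e3, phiT, gB]
    generalize Real.exp (-(δ ^ 2 * ((k:ℝ) + 1))) = u at *
    generalize Real.exp (-B * (δ ^ 2 * ((k:ℝ) + 1))) = v at *
    generalize Complex.exp (((((k:ℝ) + 1) * δ * x : ℝ) : ℂ) * Complex.I) = w at *
    push_cast
    field_simp
    ring
  rw [tsum_congr h4, h3.tsum_eq, Phi]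
  push_cast
  field_simp
  ring

section GaussFacts
open MeasureTheory ProbabilityTheory Matrix

theorem gauss_moments {r : ℕ} (A : Matrix (Fin r) (Fin r) ℝ) (k : ℕ) :
    Integrable (fun s : EuclideanSpace ℝ (Fin r) => (1 + ‖s‖) ^ k) (multivariateGaussian 0 A) := by
  have h := IsGaussian.memLp_id (multivariateGaussian (0 : EuclideanSpace ℝ (Fin r)) A) (k : ENNReal) (by simp)
  have h1 : MemLp (fun s : EuclideanSpace ℝ (Fin r) => 1 + ‖s‖) (k : ENNReal) (multivariateGaussian 0 A) :=
    (memLp_const (1:ℝ)).add h.norm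
  rcases Nat.eq_zero_or_pos k with rfl | hk
  · simp
  have h2 := h1.integrable_norm_pow (by omega)
  refine h2.congr (Filter.Eventually.of_forall fun s => ?_)
  simp only
  rw [Real.norm_of_nonneg (by positivity)]

theorem gauss_symm {r : ℕ} (A : Matrix (Fin r) (Fin r) ℝ) (hA : A.PosDef)
    (h : EuclideanSpace ℝ (Fin r) → ℂ) :
    ∫ s, h (-s) ∂(multivariateGaussian 0 A) = ∫ s, h s ∂(multivariateGaussian 0 A) := by
  have hm : (multivariateGaussian (0 : EuclideanSpace ℝ (Fin r)) A).map (fun s => -s) = multivariateGaussian 0 A := by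
    have : IsFiniteMeasure ((multivariateGaussian (0 : EuclideanSpace ℝ (Fin r)) A).map (fun s => -s)) := by
      infer_instance
    apply Measure.ext_of_charFun
    ext t
    have e := charFun_map_smul (μ := multivariateGaussian (0 : EuclideanSpace ℝ (Fin r)) A) (-1) t
    have e2 : (fun s : EuclideanSpace ℝ (Fin r) => -s) = ((-1 : ℝ) • ·) := by ext s; simp
    rw [e2, e, charFun_multivariateGaussian hA.posSemidef, charFun_multivariateGaussian hA.posSemidef]
    simp [mulVec_neg]
  conv_rhs => rw [← hm]
  have := (MeasurableEquiv.neg (EuclideanSpace ℝ (Fin r))).measurableEmbedding.integral_map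
    (μ := multivariateGaussian (0 : EuclideanSpace ℝ (Fin r)) A) h
  exact this.symm

theorem gauss_char {r : ℕ} (A : Matrix (Fin r) (Fin r) ℝ) (hA : A.PosDef) (v : Fin r → ℝ) :
    ∫ s, Complex.exp (((∑ i, v i * s i : ℝ) : ℂ) * Complex.I)
      ∂(multivariateGaussian (0 : EuclideanSpace ℝ (Fin r)) A) =
      ((Real.exp (-(1/2) * (v ⬝ᵥ A *ᵥ v)) : ℝ) : ℂ) := by
  have h := charFun_multivariateGaussian (μ := (0 : EuclideanSpace ℝ (Fin r))) hA.posSemidef (WithLp.toLp 2 v)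
  rw [charFun_apply] at h
  rw [Complex.ofReal_exp]
  convert h using 2
  · ext s
    congr 3
  · simp
    ring

/-- The integrand in the exact integral representation. -/
noncomputable def Fint {r : ℕ} (B Q : Fin r → ℝ) (δ : ℝ) (s : EuclideanSpace ℝ (Fin r)) : ℂ :=
  ∏ i, (Complex.exp (((Real.log (Q i) / δ * s i : ℝ) : ℂ) * Complex.I) *
    ∑' n : ℕ, ((((1 - Q i) * Real.exp (-(δ ^ 2 * B i)) : ℝ) : ℂ) *
      Complex.exp (((δ * s i : ℝ) : ℂ) * Complex.I)) ^ n / (qPoch (Real.exp (-δ ^ 2)) n : ℂ))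

theorem exact_rep {r : ℕ} (A : Matrix (Fin r) (Fin r) ℝ) (hA : A.PosDef) (hAs : A.IsSymm)
    (B : Fin r → ℝ) (C : ℝ) (Q : Fin r → ℝ) (hQmem : ∀ i, Q i ∈ Set.Ioo (0 : ℝ) 1)
    (hl : ∀ i, Real.log (1 - Q i) = ∑ j, A i j * Real.log (Q j))
    {δ : ℝ} (hδ : 0 < δ) (hsm : ∀ i, (1 - Q i) * Real.exp (-(δ ^ 2 * B i)) < 1) :
    Integrable (Fint B Q δ) (multivariateGaussian 0 A) ∧
    ((nahmSum A B C (Real.exp (-δ ^ 2)) : ℝ) : ℂ) =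
      ((Real.exp (-C * δ ^ 2) * Real.exp ((∑ i, Real.log (Q i) * Real.log (1 - Q i)) / (2 * δ ^ 2)) : ℝ) : ℂ) *
        ∫ s, Fint B Q δ s ∂(multivariateGaussian 0 A) := by
  set q := Real.exp (-δ ^ 2) with hq
  have hq0 : 0 < q := Real.exp_pos _
  have hq1 : q < 1 := by rw [hq, Real.exp_lt_one_iff]; nlinarith
  set μ := multivariateGaussian (0 : EuclideanSpace ℝ (Fin r)) A with hμ
  set y : Fin r → ℝ := fun i => (1 - Q i) * Real.exp (-(δ ^ 2 * B i)) with hy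
  have hy0 : ∀ i, 0 < y i := fun i => mul_pos (by linarith [(hQmem i).2]) (Real.exp_pos _)
  have hpoch : ∀ n, 0 < qPoch q n := qPoch_pos hq0 hq1
  set a : EuclideanSpace ℝ (Fin r) → Fin r → ℕ → ℂ := fun s i n =>
    Complex.exp (((Real.log (Q i) / δ * s i : ℝ) : ℂ) * Complex.I) *
      ((((y i : ℝ) : ℂ) * Complex.exp (((δ * s i : ℝ) : ℂ) * Complex.I)) ^ n / (qPoch q n : ℂ)) with ha
  have hna : ∀ s i n, ‖a s i n‖ = y i ^ n / qPoch q n := by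
    intro s i n
    rw [ha]
    simp only
    rw [norm_mul, Complex.norm_exp_ofReal_mul_I, one_mul, norm_div, norm_pow, norm_mul,
      Complex.norm_exp_ofReal_mul_I, mul_one, Complex.norm_real, Complex.norm_real,
      Real.norm_of_nonneg (hy0 i).le, Real.norm_of_nonneg (hpoch n).le]
  have hsa : ∀ s i, Summable fun n => ‖a s i n‖ := by
    intro s i
    simp only [hna]
    exact euler_summable hq0 hq1 (hy0 i).le (hsm i)
  set b : (Fin r → ℕ) → ℝ := fun n => ∏ i, (y i ^ (n i) / qPoch q (n i)) with hb
  have hnp : ∀ s n, ‖∏ i, a s i (n i)‖ = b n := by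
    intro s n
    rw [norm_prod]; simp only [hna, hb]
  have hbs : Summable b := by
    have := (hasSum_pi_prod (a 0) (hsa 0)).1
    simpa only [hnp] using this
  have hF : ∀ s, Fint B Q δ s = ∑' n : Fin r → ℕ, ∏ i, a s i (n i) := by
    intro s
    rw [(hasSum_pi_prod (a s) (hsa s)).2, Fint]
    apply Finset.prod_congr rfl
    intro i _
    rw [← tsum_mul_left]
  have hFc : Fint B Q δ = fun s => ∑' n : Fin r → ℕ, ∏ i, a s i (n i) := funext hF
  have hcont : ∀ n : Fin r → ℕ, Continuous fun s => ∏ i, a s i (n i) := by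
    intro n
    simp only [ha]
    fun_prop
  have hint1 : ∀ n : Fin r → ℕ, Integrable (fun s => ∏ i, a s i (n i)) μ := fun n =>
    Integrable.of_bound (hcont n).aestronglyMeasurable (b n) (Filter.Eventually.of_forall fun s => (hnp s n).le)
  refine ⟨?_, ?_⟩
  · rw [hFc]
    refine Integrable.of_bound (continuous_tsum hcont hbs fun n s => (hnp s n).le).aestronglyMeasurable (∑' n, b n)
      (Filter.Eventually.of_forall fun s => ?_)
    exact tsum_of_norm_bounded hbs.hasSum fun n => (hnp s n).le
  · have hsw := hasSum_integral_of_summable_integral_norm (μ := μ) hint1 (by simpa [hnp] using hbs)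
    rw [hFc, ← hsw.tsum_eq, ← tsum_mul_left, nahmSum, Complex.ofReal_tsum]
    apply tsum_congr
    intro n
    set v : Fin r → ℝ := fun i => δ * n i + Real.log (Q i) / δ with hv
    have hpt : ∀ s : EuclideanSpace ℝ (Fin r), ∏ i, a s i (n i) =
        ((b n : ℝ) : ℂ) * Complex.exp (((∑ i, v i * s i : ℝ) : ℂ) * Complex.I) := by
      intro s
      rw [hb]
      push_cast
      rw [Finset.sum_mul, Complex.exp_sum, ← Finset.prod_mul_distrib]
      apply Finset.prod_congr rfl
      intro i _
      rw [ha]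
      simp only
      rw [mul_pow, ← Complex.exp_nat_mul]
      have : Complex.exp (((v i : ℝ) : ℂ) * ((s i : ℝ) : ℂ) * Complex.I) =
          Complex.exp (((Real.log (Q i) / δ * s i : ℝ) : ℂ) * Complex.I) *
          Complex.exp ((n i : ℂ) * (((δ * s i : ℝ) : ℂ) * Complex.I)) := by
        rw [← Complex.exp_add, hv]
        congr 1
        push_cast
        ring
      rw [this]
      ring
    rw [integral_congr_ae (Filter.Eventually.of_forall hpt), integral_const_mul, gauss_char A hA]
    rw [← Complex.ofReal_mul, ← Complex.ofReal_mul]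
    congr 1
    have hbn : b n = Real.exp (∑ i, (n i : ℝ) * (Real.log (1 - Q i) - δ ^ 2 * B i)) / ∏ i, qPoch q (n i) := by
      rw [hb, Real.exp_sum, ← Finset.prod_div_distrib]
      apply Finset.prod_congr rfl
      intro i _
      congr 1
      rw [Real.exp_nat_mul, sub_eq_add_neg, Real.exp_add, Real.exp_log (by linarith [(hQmem i).2])]
    have hvv : v ⬝ᵥ A *ᵥ v = δ ^ 2 * (∑ i, ∑ j, (n i : ℝ) * A i j * (n j : ℝ)) +
        2 * (∑ i, (n i : ℝ) * Real.log (1 - Q i)) +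
        (∑ i, Real.log (Q i) * Real.log (1 - Q i)) / δ ^ 2 := by
      have hvs : v = δ • (fun i => (n i : ℝ)) + δ⁻¹ • (fun i => Real.log (Q i)) := by
        ext i; simp [hv]; ring
      have hAl : A *ᵥ (fun i => Real.log (Q i)) = fun i => Real.log (1 - Q i) := by
        ext i; simp [mulVec, dotProduct, hl]
      have e1 : (fun i => (n i : ℝ)) ⬝ᵥ A *ᵥ (fun i => (n i : ℝ)) = ∑ i, ∑ j, (n i : ℝ) * A i j * (n j : ℝ) := by
        simp [mulVec, dotProduct, Finset.mul_sum, mul_assoc]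
      have e2 : (fun i => Real.log (Q i)) ⬝ᵥ A *ᵥ (fun i => (n i : ℝ)) = ∑ i, (n i : ℝ) * Real.log (1 - Q i) := by
        rw [dotProduct_mulVec, ← mulVec_transpose, hAs.eq, hAl, dotProduct_comm]
        rfl
      rw [hvs, mulVec_add, mulVec_smul, mulVec_smul, hAl]
      simp only [dotProduct_add, add_dotProduct, smul_dotProduct, dotProduct_smul, smul_eq_mul, e1, e2]
      simp only [dotProduct]
      field_simp
      ring
    have hsum : ∑ i, (n i : ℝ) * (Real.log (1 - Q i) - δ ^ 2 * B i) =
        (∑ i, (n i : ℝ) * Real.log (1 - Q i)) - δ ^ 2 * ∑ i, (n i : ℝ) * B i := by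
      rw [Finset.mul_sum, ← Finset.sum_sub_distrib]
      exact Finset.sum_congr rfl fun i _ => by ring
    rw [hbn, hvv, hsum]
    have hX : q ^ ((1 / 2) * (∑ i, ∑ j, (n i : ℝ) * A i j * (n j : ℝ)) + (∑ i, (n i : ℝ) * B i) + C) =
        Real.exp (-C * δ ^ 2) * Real.exp ((∑ i, Real.log (Q i) * Real.log (1 - Q i)) / (2 * δ ^ 2)) *
        (Real.exp ((∑ i, (n i : ℝ) * Real.log (1 - Q i)) - δ ^ 2 * ∑ i, (n i : ℝ) * B i) *
        Real.exp (-(1/2) * (δ ^ 2 * (∑ i, ∑ j, (n i : ℝ) * A i j * (n j : ℝ)) +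
        2 * (∑ i, (n i : ℝ) * Real.log (1 - Q i)) +
        (∑ i, Real.log (Q i) * Real.log (1 - Q i)) / δ ^ 2))) := by
      rw [hq, ← Real.exp_mul, ← Real.exp_add, ← Real.exp_add, ← Real.exp_add]
      congr 1
      field_simp
      ring
    rw [hX]
    ring
end GaussFacts

section Lead
open MeasureTheory ProbabilityTheory Matrix

theorem dilog_pos {z : ℝ} (hz : 0 < z) (hz1 : z < 1) : 0 < dilog z := by
  have hs : Summable (fun k : ℕ => z ^ (k + 1) / ((k:ℝ) + 1) ^ 2) := by
    simpa using summable_K z hz hz1 0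
  exact hs.tsum_pos (fun k => by positivity) 0 (by positivity)

theorem rogers_complement {Q : ℝ} (h : Q ∈ Set.Ioo (0:ℝ) 1) :
    π ^ 2 / 6 - rogersL Q = dilog (1 - Q) + (1 / 2) * (Real.log Q * Real.log (1 - Q)) := by
  have := dilog_reflection h.1 h.2
  rw [rogersL]
  linarith

theorem lead_const {r : ℕ} (A : Matrix (Fin r) (Fin r) ℝ) (hA : A.PosDef)
    (B : Fin r → ℝ) (Q : Fin r → ℝ) (hQmem : ∀ i, Q i ∈ Set.Ioo (0 : ℝ) 1) :
    ∫ s : EuclideanSpace ℝ (Fin r), (∏ i, Complex.exp ((-(s i ^ 2 / 2) * ((1 - Q i) / (1 - (1 - Q i))) +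
        (1 / 2 - B i) * (-Real.log (1 - (1 - Q i))) : ℝ) : ℂ)) * Complex.exp 0
      ∂(multivariateGaussian 0 A) =
    (((A + diagonal fun i => Q i / (1 - Q i)).det ^ (-(1 / 2) : ℝ) *
      ∏ i, (Q i ^ (B i) * (1 - Q i) ^ (-(1 / 2) : ℝ)) : ℝ) : ℂ) := by
  set d : Fin r → ℝ := fun i => (1 - Q i) / Q i with hd
  have h0 : ∀ i, 0 < Q i := fun i => (hQmem i).1
  have h1 : ∀ i, 0 < 1 - Q i := fun i => by linarith [(hQmem i).2]
  have hd0 : ∀ i, 0 ≤ d i := fun i => (div_pos (h1 i) (h0 i)).le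
  have e1 : ∀ s : EuclideanSpace ℝ (Fin r), (∏ i, Complex.exp ((-(s i ^ 2 / 2) * ((1 - Q i) / (1 - (1 - Q i))) +
        (1 / 2 - B i) * (-Real.log (1 - (1 - Q i))) : ℝ) : ℂ)) * Complex.exp 0 =
      ((Real.exp (-(1/2) * ∑ i, d i * (s i) ^ 2) * ∏ i, Q i ^ (B i - 1 / 2) : ℝ) : ℂ) := by
    intro s
    rw [Complex.exp_zero, mul_one]
    simp only [← Complex.ofReal_exp]
    rw [← Complex.ofReal_prod]
    congr 1
    rw [Finset.mul_sum, Real.exp_sum, ← Finset.prod_mul_distrib]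
    apply Finset.prod_congr rfl
    intro i _
    rw [Real.rpow_def_of_pos (h0 i), ← Real.exp_add, hd, sub_sub_cancel]
    congr 1
    ring
  rw [integral_congr_ae (Filter.Eventually.of_forall e1), integral_complex_ofReal, integral_mul_const,
    gauss_const A hA d hd0]
  congr 1
  have hdet : (A + diagonal fun i => Q i / (1 - Q i)).det = (∏ i, Q i / (1 - Q i)) * (1 + diagonal d * A).det := by
    have : A + (diagonal fun i => Q i / (1 - Q i)) = (diagonal fun i => Q i / (1 - Q i)) * (1 + diagonal d * A) := by
      rw [mul_add, mul_one, ← mul_assoc, diagonal_mul_diagonal]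
      have : (fun i => Q i / (1 - Q i) * d i) = fun _ => 1 := by
        ext i
        rw [hd]
        have := (h0 i).ne'
        have := (h1 i).ne'
        field_simp
      rw [this, diagonal_one, one_mul, add_comm]
    rw [this, det_mul, det_diagonal]
  have hξ : PosDef (diagonal fun i => Q i / (1 - Q i)) := PosDef.diagonal fun i => div_pos (h0 i) (h1 i)
  have hp1 : 0 < (A + diagonal fun i => Q i / (1 - Q i)).det := (hA.add hξ).det_pos
  have hp2 : 0 < ∏ i, Q i / (1 - Q i) := Finset.prod_pos fun i _ => div_pos (h0 i) (h1 i)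
  have hp3 : 0 < (1 + diagonal d * A).det := by
    rw [hdet] at hp1
    exact (pos_iff_pos_of_mul_pos hp1).1 hp2
  rw [hdet, Real.mul_rpow hp2.le hp3.le, ← Real.finsetProd_rpow _ _ (fun i _ => (div_pos (h0 i) (h1 i)).le),
    mul_comm (∏ i, _) (_ ^ _), mul_assoc, ← Finset.prod_mul_distrib]
  congr 1
  apply Finset.prod_congr rfl
  intro i _
  rw [Real.div_rpow (h0 i).le (h1 i).le, sub_eq_add_neg, Real.rpow_add (h0 i)]
  have : (1 - Q i) ^ (-(1/2) : ℝ) ≠ 0 := (Real.rpow_pos_of_pos (h1 i) _).ne'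
  field_simp

theorem expansion_delta {r : ℕ}
    (A : Matrix (Fin r) (Fin r) ℝ) (hA : A.PosDef) (hAs : A.IsSymm)
    (B : Fin r → ℝ) (C : ℝ)
    (Q : Fin r → ℝ) (hQmem : ∀ i, Q i ∈ Set.Ioo (0 : ℝ) 1)
    (hQ : ∀ i, 1 - Q i = ∏ j, (Q j) ^ (A i j))
    (α β γ : ℝ)
    (hα : α = ∑ i, (π ^ 2 / 6 - rogersL (Q i)))
    (hβ : β = (A + diagonal fun i => Q i / (1 - Q i)).det ^ (-(1 / 2) : ℝ) *
      ∏ i, (Q i ^ (B i) * (1 - Q i) ^ (-(1 / 2) : ℝ))) (N : ℕ) (hN : 1 ≤ N) :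
    ∃ P : Polynomial ℂ, P.comp (-Polynomial.X) = P ∧ P.coeff 0 = (β : ℂ) ∧
      ∃ D δ₀ : ℝ, 0 < δ₀ ∧ ∀ δ, 0 < δ → δ < δ₀ →
        ‖((nahmSum A B C (Real.exp (-δ ^ 2)) * Real.exp (-α / δ ^ 2) * Real.exp (γ * δ ^ 2) : ℝ) : ℂ)
          - P.eval (δ:ℂ)‖ ≤ D * δ ^ N := by
  have h0 : ∀ i, 0 < Q i := fun i => (hQmem i).1
  have h1 : ∀ i, 0 < 1 - Q i := fun i => by linarith [(hQmem i).2]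
  have hl : ∀ i, Real.log (1 - Q i) = ∑ j, A i j * Real.log (Q j) := by
    intro i
    rw [hQ i, Real.log_prod (fun j _ => (Real.rpow_pos_of_pos (h0 j) _).ne')]
    exact Finset.sum_congr rfl fun j _ => Real.log_rpow (h0 j) _
  choose ρ d hρ0 hρ1 hd0 hd1 hρ using fun i => rho_exists (1 - Q i) (|B i| + 1) (h1 i) (by linarith [h0 i]) (by positivity)
  -- common small parameter
  obtain ⟨δ₁, hδ₁, hδ₁1, hδ₁d⟩ : ∃ δ₁ : ℝ, 0 < δ₁ ∧ δ₁ ≤ 1 ∧ ∀ i, δ₁ ≤ d i := by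
    have : ∀ t : Finset (Fin r), ∃ δ₁ : ℝ, 0 < δ₁ ∧ δ₁ ≤ 1 ∧ ∀ i ∈ t, δ₁ ≤ d i := by
      intro t
      induction t using Finset.induction_on with
      | empty => exact ⟨1, one_pos, le_rfl, by simp⟩
      | insert i t hi ih =>
        obtain ⟨e, he, he1, hed⟩ := ih
        refine ⟨min e (d i), lt_min he (hd0 i), (min_le_left _ _).trans he1, fun j hj => ?_⟩
        rcases Finset.mem_insert.1 hj with rfl | hj
        · exact min_le_right _ _
        · exact (min_le_left _ _).trans (hed j hj)
    obtain ⟨e, he, he1, hed⟩ := this Finset.univ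
    exact ⟨e, he, he1, fun i => hed i (Finset.mem_univ i)⟩
  have hfac : ∀ i : Fin r, Asy N (fun δ (s : EuclideanSpace ℝ (Fin r)) => Complex.exp (Phi (B i) (1 - Q i) δ (s i)))
      (fun s => Complex.exp ((-(s i ^ 2 / 2) * ((1 - Q i) / (1 - (1 - Q i))) +
        (1 / 2 - B i) * (-Real.log (1 - (1 - Q i))) : ℝ) : ℂ)) := by
    intro i
    have hz1 : 1 - Q i < 1 := by linarith [h0 i]
    have hph := Phi_asy (EuclideanSpace.proj i : EuclideanSpace ℝ (Fin r) →L[ℝ] ℝ) (B i) (h1 i) hz1 N hN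
    obtain ⟨K, hK⟩ := Phi_re_le (B i) (h1 i) hz1 (hρ0 i) (hρ1 i)
    refine Asy.exp hN hph (K := max K ((1 / 2 - B i) * (-Real.log (1 - (1 - Q i))))) hδ₁ ?_ ?_
    · intro δ hδ hδ' s
      exact (hK δ (hρ i δ hδ (hδ'.trans_le (hδ₁d i))) hδ (hδ'.trans_le hδ₁1) _).trans (le_max_left _ _)
    · intro s
      refine le_trans ?_ (le_max_right _ _)
      rw [Complex.ofReal_re]
      have : 0 ≤ (1 - Q i) / (1 - (1 - Q i)) := by rw [sub_sub_cancel]; exact (div_pos (h1 i) (h0 i)).le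
      nlinarith [sq_nonneg ((EuclideanSpace.proj i : EuclideanSpace ℝ (Fin r) →L[ℝ] ℝ) s)]
  have hgam : Asy N (fun (δ : ℝ) (_ : EuclideanSpace ℝ (Fin r)) => Complex.exp (((γ - C : ℝ) : ℂ) * (δ:ℂ) ^ 2))
      (fun _ => Complex.exp 0) := by
    have hm := Asy.monomial N 2 (⟨_, SR_const_mem ((γ - C : ℝ) : ℂ)⟩ : SR (EuclideanSpace ℝ (Fin r))) (by simp)
    have := Asy.exp hN hm (K := |γ - C|) one_pos ?_ ?_
    · simpa using this
    · intro δ hδ hδ' s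
      change ((((γ - C : ℝ) : ℂ)) * (δ:ℂ) ^ 2).re ≤ _
      rw [← Complex.ofReal_pow, ← Complex.ofReal_mul, Complex.ofReal_re]
      refine (le_abs_self _).trans ?_
      rw [abs_mul, abs_of_pos (pow_pos hδ 2)]
      exact mul_le_of_le_one_right (abs_nonneg _) (pow_le_one₀ hδ.le hδ'.le)
    · intro s; simp
  have hall := (Asy.prod Finset.univ (fun i _ => hfac i)).mul hgam
  have hkey : ∀ δ, 0 < δ → δ < δ₁ → ∀ s : EuclideanSpace ℝ (Fin r),
      (∏ i, Complex.exp (Phi (B i) (1 - Q i) δ (s i))) * Complex.exp (((γ - C : ℝ) : ℂ) * (δ:ℂ) ^ 2) =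
      ((Real.exp (-(∑ i, dilog (1 - Q i)) / δ ^ 2) * Real.exp ((γ - C) * δ ^ 2) : ℝ) : ℂ) * Fint B Q δ s := by
    intro δ hδ hδ' s
    have e : ∀ i, Complex.exp (Phi (B i) (1 - Q i) δ (s i)) = ((Real.exp (-(dilog (1 - Q i) / δ ^ 2)) : ℝ) : ℂ) *
        (Complex.exp (((Real.log (Q i) / δ * s i : ℝ) : ℂ) * Complex.I) *
    ∑' n : ℕ, ((((1 - Q i) * Real.exp (-(δ ^ 2 * B i)) : ℝ) : ℂ) *
      Complex.exp (((δ * s i : ℝ) : ℂ) * Complex.I)) ^ n / (qPoch (Real.exp (-δ ^ 2)) n : ℂ)) := by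
      intro i
      rw [← f_eq_exp_Phi (B i) (h1 i) (by linarith [h0 i]) (hρ0 i) (hρ1 i) (hρ i δ hδ (hδ'.trans_le (hδ₁d i)))
        hδ (hδ'.trans_le hδ₁1) (s i), sub_sub_cancel, sub_eq_add_neg, Complex.exp_add, Complex.ofReal_exp,
        Complex.ofReal_neg]
      ring
    simp only [e]
    rw [Finset.prod_mul_distrib, ← Complex.ofReal_prod, ← Real.exp_sum, Fint, Finset.sum_neg_distrib,
      ← Finset.sum_div, neg_div]
    push_cast
    ring
  have hsm : ∀ δ, 0 < δ → δ < δ₁ → ∀ i, (1 - Q i) * Real.exp (-(δ ^ 2 * B i)) < 1 := by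
    intro δ hδ hδ' i
    refine lt_of_le_of_lt (le_trans ?_ (hρ i δ hδ (hδ'.trans_le (hδ₁d i)))) (hρ1 i)
    have := (h1 i).le
    gcongr
    nlinarith [neg_abs_le (B i), sq_nonneg δ]
  have hrep := fun δ hδ hδ' => exact_rep A hA hAs B C Q hQmem hl (δ := δ) hδ (hsm δ hδ hδ')
  obtain ⟨P, hP1, hP2, D, δ₀, hδ₀, hD⟩ := Asy.integral (multivariateGaussian 0 A) (gauss_moments A) (gauss_symm A hA) hall hδ₁ (by
    intro δ hδ hδ'
    simp only [hkey δ hδ hδ']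
    exact (hrep δ hδ hδ').1.const_mul _)
  refine ⟨P, hP1, ?_, D, min δ₀ δ₁, lt_min hδ₀ hδ₁, fun δ hδ hδ' => ?_⟩
  · rw [hP2, hβ]
    exact lead_const A hA B Q hQmem
  · have hb := hD δ hδ (hδ'.trans_le (min_le_left _ _))
    have hδ'' := hδ'.trans_le (min_le_right δ₀ δ₁)
    simp only [hkey δ hδ hδ''] at hb
    rw [integral_const_mul] at hb
    rw [Complex.ofReal_mul, Complex.ofReal_mul, (hrep δ hδ hδ'').2]
    convert hb using 3
    have hgen : ∀ a b c J : ℂ, a * J * b * c = a * b * c * J := by intros; ring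
    rw [hgen, ← Complex.ofReal_mul, ← Complex.ofReal_mul]
    congr 2
    rw [← Real.exp_add, ← Real.exp_add, ← Real.exp_add, ← Real.exp_add]
    congr 1
    have : α = (∑ i, dilog (1 - Q i)) + (1 / 2) * ∑ i, Real.log (Q i) * Real.log (1 - Q i) := by
      rw [hα, Finset.mul_sum, ← Finset.sum_add_distrib]
      exact Finset.sum_congr rfl fun i _ => rogers_complement (hQmem i)
    rw [this]
    field_simp
    ring
end Lead

theorem poly_coeff_zero_of_isBigO (M : ℕ) : ∀ p : Polynomial ℝ,
    (fun ε : ℝ => p.eval ε) =O[nhdsWithin 0 (Set.Ioi 0)] (fun ε : ℝ => ε ^ M) → ∀ k < M, p.coeff k = 0 := by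
  induction M with
  | zero => intro p _ k hk; omega
  | succ M ih =>
    intro p hp
    have h0 : p.coeff 0 = 0 := by
      have t1 : Filter.Tendsto (fun ε : ℝ => ε ^ (M + 1)) (nhdsWithin 0 (Set.Ioi 0)) (nhds 0) := by
        have : Filter.Tendsto (fun ε : ℝ => ε ^ (M + 1)) (nhds 0) (nhds (0 ^ (M + 1))) :=
          (continuous_pow (M + 1)).tendsto 0
        rw [zero_pow (by omega)] at this
        exact this.mono_left nhdsWithin_le_nhds
      have t2 := hp.trans_tendsto t1
      have t3 : Filter.Tendsto (fun ε : ℝ => p.eval ε) (nhdsWithin 0 (Set.Ioi 0)) (nhds (p.eval 0)) :=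
        (p.continuous.tendsto 0).mono_left nhdsWithin_le_nhds
      rw [Polynomial.coeff_zero_eq_eval_zero]
      exact tendsto_nhds_unique t3 t2
    have hdiv : (fun ε : ℝ => p.divX.eval ε) =O[nhdsWithin 0 (Set.Ioi 0)] (fun ε : ℝ => ε ^ M) := by
      have h1 := (isBigO_refl (fun ε : ℝ => ε⁻¹) (nhdsWithin 0 (Set.Ioi 0))).mul hp
      refine h1.congr' ?_ ?_
      · filter_upwards [self_mem_nhdsWithin] with ε hε
        have hε : (0:ℝ) < ε := hε
        have : p.eval ε = p.divX.eval ε * ε := by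
          conv_lhs => rw [← Polynomial.divX_mul_X_add p, h0]
          simp
        rw [this]; field_simp
      · filter_upwards [self_mem_nhdsWithin] with ε hε
        have hε : (0:ℝ) < ε := hε
        rw [pow_succ]; field_simp
    intro k hk
    rcases k with _ | k
    · exact h0
    · rw [← Polynomial.coeff_divX]; exact ih _ hdiv k (by omega)

theorem even_poly_real (P : Polynomial ℂ) (hP : P.comp (-Polynomial.X) = P) :
    ∃ R : Polynomial ℝ, R.coeff 0 = (P.coeff 0).re ∧ ∀ δ : ℝ, (P.eval (δ:ℂ)).re = R.eval (δ ^ 2) := by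
  set S := P.contract 2 with hS
  have hodd : ∀ n, ¬ 2 ∣ n → P.coeff n = 0 := by
    intro n hn
    have h1 : (P.comp (-Polynomial.X)).coeff n = P.coeff n := by rw [hP]
    rw [show (-Polynomial.X : Polynomial ℂ) = Polynomial.C (-1) * Polynomial.X by simp,
      Polynomial.comp_C_mul_X_coeff] at h1
    have : Odd n := Nat.not_even_iff_odd.1 fun h => hn h.two_dvd
    rw [this.neg_one_pow] at h1
    have h2 : (2:ℂ) * P.coeff n = 0 := by linear_combination -h1
    simpa using h2
  have hexp : Polynomial.expand ℂ 2 S = P := by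
    ext n
    rw [Polynomial.coeff_expand (by norm_num)]
    split_ifs with h
    · rw [hS, Polynomial.coeff_contract (by norm_num), Nat.div_mul_cancel h]
    · exact (hodd n h).symm
  refine ⟨∑ k ∈ Finset.range (S.natDegree + 1), Polynomial.monomial k (S.coeff k).re, ?_, ?_⟩
  · rw [Polynomial.finsetSum_coeff, Finset.sum_range_succ']
    simp [Polynomial.coeff_monomial, hS, Polynomial.coeff_contract]
  · intro δ
    conv_lhs => rw [← hexp]
    rw [Polynomial.expand_eval, Polynomial.eval_eq_sum_range, Complex.re_sum, Polynomial.eval_finsetSum]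
    apply Finset.sum_congr rfl
    intro k _
    rw [Polynomial.eval_monomial, ← Complex.ofReal_pow, ← Complex.ofReal_pow, Complex.re_mul_ofReal]

theorem final_assembly (G : ℝ → ℝ) (β : ℝ) (hβ : β ≠ 0)
    (h : ∀ N : ℕ, 1 ≤ N → ∃ P : Polynomial ℂ, P.comp (-Polynomial.X) = P ∧ P.coeff 0 = (β : ℂ) ∧
      ∃ D δ₀ : ℝ, 0 < δ₀ ∧ ∀ δ, 0 < δ → δ < δ₀ → ‖((G (δ ^ 2) : ℝ) : ℂ) - P.eval (δ:ℂ)‖ ≤ D * δ ^ N) :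
    ∃ c : ℕ → ℝ, ∀ N : ℕ, (fun ε : ℝ => G ε - β * (1 + ∑ p ∈ Finset.Icc 1 N, c p * ε ^ p))
        =o[nhdsWithin 0 (Set.Ioi 0)] (fun ε : ℝ => ε ^ N) := by
  have hR : ∀ M : ℕ, ∃ R : Polynomial ℝ, R.coeff 0 = β ∧
      (fun ε : ℝ => G ε - R.eval ε) =O[nhdsWithin 0 (Set.Ioi 0)] (fun ε : ℝ => ε ^ (M + 1)) := by
    intro M
    obtain ⟨P, hP, hP0, D, δ₀, hδ₀, hD⟩ := h (2 * (M + 1)) (by omega)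
    obtain ⟨R, hR0, hR⟩ := even_poly_real P hP
    refine ⟨R, by rw [hR0, hP0, Complex.ofReal_re], ?_⟩
    apply IsBigO.of_bound D
    have : Set.Ioo (0:ℝ) (δ₀ ^ 2) ∈ nhdsWithin (0:ℝ) (Set.Ioi 0) :=
      Ioo_mem_nhdsGT (by positivity)
    filter_upwards [this] with ε hε
    have hs : 0 < √ε := Real.sqrt_pos.2 hε.1
    have hs2 : √ε ^ 2 = ε := Real.sq_sqrt hε.1.le
    have hb := hD (√ε) hs ((Real.sqrt_lt' hδ₀).2 hε.2)
    rw [pow_mul, hs2] at hb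
    have hre := (Complex.abs_re_le_norm _).trans hb
    rw [Complex.sub_re, Complex.ofReal_re, hR, hs2] at hre
    rwa [Real.norm_eq_abs, Real.norm_of_nonneg (pow_nonneg hε.1.le _)]
  choose R hR0 hR using hR
  have hcoh : ∀ M N k : ℕ, k ≤ M → M ≤ N → (R M).coeff k = (R N).coeff k := by
    intro M N k hk hMN
    have h1 : (fun ε : ℝ => ε ^ (N + 1)) =O[nhdsWithin 0 (Set.Ioi 0)] (fun ε : ℝ => ε ^ (M + 1)) := by
      apply IsBigO.of_bound 1
      have : Set.Ioo (0:ℝ) 1 ∈ nhdsWithin (0:ℝ) (Set.Ioi 0) := Ioo_mem_nhdsGT one_pos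
      filter_upwards [this] with ε hε
      rw [Real.norm_of_nonneg (pow_nonneg hε.1.le _), Real.norm_of_nonneg (pow_nonneg hε.1.le _), one_mul]
      exact pow_le_pow_of_le_one hε.1.le hε.2.le (by omega)
    have h2 := ((hR N).trans h1).sub (hR M)
    have h3 := poly_coeff_zero_of_isBigO (M + 1) (R M - R N) (by
      refine h2.congr (fun ε => ?_) (fun ε => rfl)
      rw [Polynomial.eval_sub]; ring) k (by omega)
    rw [Polynomial.coeff_sub] at h3
    linarith
  refine ⟨fun p => (R p).coeff p / β, fun N => ?_⟩
  have hlit : (fun ε : ℝ => ε ^ (N + 1)) =o[nhdsWithin 0 (Set.Ioi 0)] (fun ε : ℝ => ε ^ N) :=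
    (isLittleO_pow_pow (by omega : N < N + 1)).mono nhdsWithin_le_nhds
  have hsum : ∀ ε : ℝ, β * (1 + ∑ p ∈ Finset.Icc 1 N, (R p).coeff p / β * ε ^ p) =
      ∑ p ∈ Finset.range (N + 1), (R N).coeff p * ε ^ p := by
    intro ε
    rw [Finset.sum_range_succ', pow_zero, mul_one, hR0, mul_add, mul_one, add_comm, Finset.mul_sum]
    congr 1
    rw [Finset.sum_bij (fun p _ => p - 1) (t := Finset.range N) (g := fun p => (R N).coeff (p + 1) * ε ^ (p + 1))]
    · intro p hp; simp at hp ⊢; omega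
    · intro p hp p2 hp2 he; simp at hp hp2 he; omega
    · intro p hp; exact ⟨p + 1, by simp at hp ⊢; omega, by simp⟩
    · intro p hp
      have hp' := Finset.mem_Icc.1 hp
      rw [Nat.sub_add_cancel hp'.1, hcoh p N p le_rfl hp'.2]
      field_simp
  have htail : (fun ε : ℝ => (R N).eval ε - ∑ p ∈ Finset.range (N + 1), (R N).coeff p * ε ^ p)
      =O[nhdsWithin 0 (Set.Ioi 0)] (fun ε : ℝ => ε ^ (N + 1)) := by
    obtain ⟨T, hT⟩ : (Polynomial.X : Polynomial ℝ) ^ (N + 1) ∣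
        R N - ∑ p ∈ Finset.range (N + 1), Polynomial.monomial p ((R N).coeff p) := by
      rw [Polynomial.X_pow_dvd_iff]
      intro k hk
      rw [Polynomial.coeff_sub, Polynomial.finsetSum_coeff]
      simp only [Polynomial.coeff_monomial]
      rw [Finset.sum_ite_eq' ]
      simp [hk]
    have he : ∀ ε : ℝ, (R N).eval ε - ∑ p ∈ Finset.range (N + 1), (R N).coeff p * ε ^ p = ε ^ (N + 1) * T.eval ε := by
      intro ε
      have := congrArg (Polynomial.eval ε) hT
      simpa [Polynomial.eval_finsetSum] using this
    simp only [he]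
    have hb : (fun ε : ℝ => T.eval ε) =O[nhdsWithin 0 (Set.Ioi 0)] (fun _ : ℝ => (1:ℝ)) :=
      ((T.continuous.tendsto 0).mono_left nhdsWithin_le_nhds).isBigO_one ℝ
    simpa using (isBigO_refl (fun ε : ℝ => ε ^ (N + 1)) _).mul hb
  refine (((hR N).add htail).trans_isLittleO hlit).congr (fun ε => ?_) (fun ε => rfl)
  rw [hsum]; ring

/-- Asymptotics of the Nahm sum: with `Q` the unique solution of the
Nahm system in `(0,1)^r`, `ξᵢ = Qᵢ/(1-Qᵢ)`, `Ã = A + diag ξ`,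
`α = ∑ᵢ (π²/6 - L(Qᵢ)) > 0`, `β = det(Ã)^{-1/2} ∏ᵢ Qᵢ^{Bᵢ}(1-Qᵢ)^{-1/2} > 0` and
`γ = C + (1/24) ∑ᵢ (1+Qᵢ)/(1-Qᵢ)`, there are reals `c_p` such that for each `N`,
`F_{A,B,C}(e^{-ε}) e^{-α/ε} - β e^{-γε} (1 + ∑_{p=1}^N c_p ε^p) = o(ε^N)` as `ε → 0⁺`. -/
theorem nahmSum_asymptotic_expansion {r : ℕ} (hr : 1 ≤ r)
    (A : Matrix (Fin r) (Fin r) ℝ) (hA : A.PosDef) (hAs : A.IsSymm)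
    (B : Fin r → ℝ) (C : ℝ)
    (Q : Fin r → ℝ) (hQmem : ∀ i, Q i ∈ Set.Ioo (0 : ℝ) 1)
    (hQ : ∀ i, 1 - Q i = ∏ j, (Q j) ^ (A i j))
    (ξ : Fin r → ℝ) (hξ : ξ = fun i => Q i / (1 - Q i))
    (At : Matrix (Fin r) (Fin r) ℝ) (hAt : At = A + Matrix.diagonal ξ)
    (α β γ : ℝ)
    (hα : α = ∑ i, (π ^ 2 / 6 - rogersL (Q i)))
    (hβ : β = At.det ^ (-(1 / 2) : ℝ) * ∏ i, (Q i ^ (B i) * (1 - Q i) ^ (-(1 / 2) : ℝ)))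
    (hγ : γ = C + (1 / 24) * ∑ i, (1 + Q i) / (1 - Q i)) :
    0 < α ∧ 0 < β ∧
    ∃ c : ℕ → ℝ, ∀ N : ℕ,
      (fun ε : ℝ => nahmSum A B C (Real.exp (-ε)) * Real.exp (-α / ε) -
          β * Real.exp (-γ * ε) * (1 + ∑ p ∈ Finset.Icc 1 N, c p * ε ^ p))
        =o[nhdsWithin 0 (Set.Ioi 0)] (fun ε : ℝ => ε ^ N) := by
  subst hξ hAt
  have h0 : ∀ i, 0 < Q i := fun i => (hQmem i).1
  have h1 : ∀ i, 0 < 1 - Q i := fun i => by linarith [(hQmem i).2]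
  have hαpos : 0 < α := by
    rw [hα]
    apply Finset.sum_pos
    · intro i _
      rw [rogers_complement (hQmem i)]
      have a1 := dilog_pos (h1 i) (by linarith [h0 i])
      have a2 := Real.log_neg (h0 i) (hQmem i).2
      have a3 := Real.log_neg (h1 i) (by linarith [h0 i])
      have a4 := mul_pos_of_neg_of_neg a2 a3
      linarith
    · exact ⟨⟨0, by omega⟩, Finset.mem_univ _⟩
  have hβpos : 0 < β := by
    rw [hβ]
    apply mul_pos
    · apply Real.rpow_pos_of_pos
      exact (hA.add (Matrix.PosDef.diagonal fun i => div_pos (h0 i) (h1 i))).det_pos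
    · exact Finset.prod_pos fun i _ =>
        mul_pos (Real.rpow_pos_of_pos (h0 i) _) (Real.rpow_pos_of_pos (h1 i) _)
  refine ⟨hαpos, hβpos, ?_⟩
  obtain ⟨c, hc⟩ := final_assembly
    (fun ε => nahmSum A B C (Real.exp (-ε)) * Real.exp (-α / ε) * Real.exp (γ * ε)) β hβpos.ne'
    (fun N hN => expansion_delta A hA hAs B C Q hQmem hQ α β γ hα hβ N hN)
  refine ⟨c, fun N => ?_⟩
  have hb : (fun ε : ℝ => Real.exp (-γ * ε)) =O[nhdsWithin 0 (Set.Ioi 0)] (fun _ : ℝ => (1:ℝ)) := by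
    have hcont : Continuous (fun ε : ℝ => Real.exp (-γ * ε)) := by fun_prop
    exact ((hcont.tendsto 0).mono_left nhdsWithin_le_nhds).isBigO_one ℝ
  refine (hb.mul_isLittleO (hc N)).congr (fun ε => ?_) (fun ε => one_mul _)
  have he : Real.exp (-γ * ε) * Real.exp (γ * ε) = 1 := by
    rw [← Real.exp_add]; simp
  linear_combination (nahmSum A B C (Real.exp (-ε)) * Real.exp (-α / ε)) * he
end

section
/- Let m ≥ 1 and n ≥ 0 be integers and let q ∈ (0,1). Then q^{n²/2}/(q;q)_n = ∑ q^{(m/2)(k₁²+⋯+k_m²) + ∑_{j=1}^m ((2j−m−1)/2)·k_j} / ((q^m;q^m)_{k₁}⋯(q^m;q^m)_{k_m}), where the sum runs over all k = (k₁,…,k_m) ∈ (ℤ_{≥0})^m with k₁+⋯+k_m = n. -/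
open Real

open PowerSeries in
/-- Generating function `∑ Q^{n²/2} z^n / (Q;Q)_n`. -/
noncomputable def eulerE (Q : ℝ) : PowerSeries ℝ :=
  PowerSeries.mk fun n => Q ^ (((n : ℝ) ^ 2) / 2) / qPoch Q n

lemma one_sub_pow_ne {q : ℝ} (hq : q ∈ Set.Ioo (0 : ℝ) 1) (n : ℕ) : 1 - q ^ (n + 1) ≠ 0 := by
  have := pow_lt_one₀ hq.1.le hq.2 (Nat.succ_ne_zero n)
  exact (sub_pos.2 this).ne'

lemma qPoch_ne {q : ℝ} (hq : q ∈ Set.Ioo (0 : ℝ) 1) (n : ℕ) : qPoch q n ≠ 0 :=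
  Finset.prod_ne_zero_iff.2 fun k _ => one_sub_pow_ne hq k

lemma eulerE_eq {q : ℝ} (hq : q ∈ Set.Ioo (0 : ℝ) 1) :
    eulerE q = (1 + PowerSeries.C (q ^ (1 / 2 : ℝ)) * PowerSeries.X) *
      PowerSeries.rescale q (eulerE q) := by
  ext n
  rw [add_mul, one_mul, mul_assoc, map_add, PowerSeries.coeff_C_mul]
  cases n with
  | zero => simp
  | succ n =>
    rw [PowerSeries.coeff_succ_X_mul, PowerSeries.coeff_rescale, PowerSeries.coeff_rescale]
    simp only [eulerE, PowerSeries.coeff_mk]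
    have h1 := one_sub_pow_ne hq n
    have h2 := qPoch_ne hq n
    have h3 : qPoch q (n + 1) = qPoch q n * (1 - q ^ (n + 1)) := by
      simp [qPoch, Finset.prod_range_succ]
    have h4 : q ^ ((((n + 1 : ℕ) : ℝ) ^ 2) / 2)
        = q ^ (1 / 2 : ℝ) * (q ^ n * q ^ (((n : ℝ) ^ 2) / 2)) := by
      rw [← Real.rpow_natCast q n, ← Real.rpow_add hq.1, ← Real.rpow_add hq.1]
      congr 1
      push_cast
      ring
    rw [h3, h4]
    field_simp
    ring

lemma unique_aux {q : ℝ} (hq : q ∈ Set.Ioo (0 : ℝ) 1) (a : ℝ) (F G : PowerSeries ℝ)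
    (hF : F = (1 + PowerSeries.C a * PowerSeries.X) * PowerSeries.rescale q F)
    (hG : G = (1 + PowerSeries.C a * PowerSeries.X) * PowerSeries.rescale q G)
    (h0 : PowerSeries.coeff 0 F = PowerSeries.coeff 0 G) : F = G := by
  have key : ∀ (F : PowerSeries ℝ),
      F = (1 + PowerSeries.C a * PowerSeries.X) * PowerSeries.rescale q F → ∀ n,
      PowerSeries.coeff (n + 1) F * (1 - q ^ (n + 1)) = a * (q ^ n * PowerSeries.coeff n F) := by
    intro F hF n
    have := congrArg (PowerSeries.coeff (n + 1)) hF
    rw [add_mul, one_mul, mul_assoc, map_add, PowerSeries.coeff_C_mul,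
      PowerSeries.coeff_succ_X_mul, PowerSeries.coeff_rescale, PowerSeries.coeff_rescale] at this
    linarith
  ext n
  induction n with
  | zero => exact h0
  | succ n ih =>
    apply mul_right_cancel₀ (one_sub_pow_ne hq n)
    rw [key F hF, key G hG, ih]

lemma eulerE_prod {q : ℝ} (hq : q ∈ Set.Ioo (0 : ℝ) 1) (M : ℕ) :
    eulerE q = ∏ j : Fin (M + 1), PowerSeries.rescale
      (q ^ ((2 * ((j : ℕ) : ℝ) + 1 - ((M + 1 : ℕ) : ℝ)) / 2)) (eulerE (q ^ (M + 1))) := by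
  have hQ : q ^ (M + 1) ∈ Set.Ioo (0 : ℝ) 1 :=
    ⟨pow_pos hq.1 _, pow_lt_one₀ hq.1.le hq.2 (Nat.succ_ne_zero M)⟩
  set E := eulerE (q ^ (M + 1)) with hE
  set c : ℕ → ℝ := fun j => q ^ ((2 * (j : ℝ) + 1 - ((M + 1 : ℕ) : ℝ)) / 2) with hc
  have hcs : ∀ j, c j * q = c (j + 1) := by
    intro j
    simp only [hc]
    nth_rewrite 2 [← Real.rpow_one q]
    rw [← Real.rpow_add hq.1]
    congr 1
    push_cast
    ring
  rw [show (∏ j : Fin (M + 1), PowerSeries.rescale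
      (q ^ ((2 * ((j : ℕ) : ℝ) + 1 - ((M + 1 : ℕ) : ℝ)) / 2)) E)
      = ∏ j ∈ Finset.range (M + 1), PowerSeries.rescale (c j) E from
      (Finset.prod_range (fun j => PowerSeries.rescale (c j) E)).symm]
  apply unique_aux hq (q ^ (1 / 2 : ℝ)) _ _ (eulerE_eq hq)
  · rw [map_prod]
    simp only [PowerSeries.rescale_rescale, hcs]
    rw [Finset.prod_range_succ', Finset.prod_range_succ (fun j => PowerSeries.rescale (c (j + 1)) E)]
    have h0 : PowerSeries.rescale (c 0) E
        = (1 + PowerSeries.C (q ^ (1 / 2 : ℝ)) * PowerSeries.X) *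
          PowerSeries.rescale (c (M + 1)) E := by
      have h1 : (q ^ (M + 1)) ^ (1 / 2 : ℝ) * c 0 = q ^ (1 / 2 : ℝ) := by
        simp only [hc]
        rw [← Real.rpow_natCast q, ← Real.rpow_mul hq.1.le, ← Real.rpow_add hq.1]
        congr 1
        push_cast
        ring
      have h2 : q ^ (M + 1) * c 0 = c (M + 1) := by
        simp only [hc]
        rw [← Real.rpow_natCast q, ← Real.rpow_add hq.1]
        congr 1
        push_cast
        ring
      conv_lhs => rw [hE, eulerE_eq hQ]
      rw [map_mul, PowerSeries.rescale_rescale, h2, ← hE]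
      congr 1
      ext n
      rw [PowerSeries.coeff_rescale]
      simp only [map_add, PowerSeries.coeff_C_mul, PowerSeries.coeff_X, PowerSeries.coeff_one]
      rcases n with _ | _ | n
      · simp
      · rw [← h1]
        simp [mul_comm]
      · simp
    rw [h0]
    ring
  · have h : ∀ Q : ℝ, PowerSeries.constantCoeff (eulerE Q) = 1 := by
      intro Q
      rw [← PowerSeries.coeff_zero_eq_constantCoeff_apply]
      simp [eulerE, qPoch]
    have h' : ∀ j, PowerSeries.constantCoeff (PowerSeries.rescale (c j) E) = 1 := by
      intro j
      rw [← PowerSeries.coeff_zero_eq_constantCoeff_apply, PowerSeries.coeff_rescale, hE]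
      simp [h]
    simp [h, h', map_prod]

/-- For integers `m ≥ 1`, `n ≥ 0` and `q ∈ (0,1)`:
`q^{n²/2}/(q;q)_n = ∑_{k₁+⋯+k_m = n} q^{(m/2)(k₁²+⋯+k_m²) + ∑_j ((2j-m-1)/2) k_j}
  / ((q^m;q^m)_{k₁} ⋯ (q^m;q^m)_{k_m})`
(with `1 ≤ j ≤ m` in the exponent; below `j` is 0-based so `(2j-m-1)/2` becomes
`(2j+1-m)/2`). -/
theorem qpow_sq_div_qPoch_eq_sum {m : ℕ} (hm : 1 ≤ m) (n : ℕ)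
    (q : ℝ) (hq : q ∈ Set.Ioo (0 : ℝ) 1) :
    q ^ (((n : ℝ) ^ 2) / 2) / qPoch q n =
      ∑' k : Fin m → ℕ,
        if (∑ j, k j) = n then
          q ^ (((m : ℝ) / 2) * (∑ j, ((k j : ℝ)) ^ 2) +
                ∑ j : Fin m, ((2 * ((j : ℕ) : ℝ) + 1 - (m : ℝ)) / 2) * (k j : ℝ)) /
            ∏ j, qPoch (q ^ m) (k j)
        else 0 := by
  obtain ⟨M, rfl⟩ : ∃ M, m = M + 1 := ⟨m - 1, by omega⟩
  have h := congrArg (PowerSeries.coeff n) (eulerE_prod hq M)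
  rw [PowerSeries.coeff_prod] at h
  simp only [PowerSeries.coeff_rescale] at h
  simp only [eulerE, PowerSeries.coeff_mk] at h
  rw [h, tsum_eq_sum (s := Finset.piAntidiag Finset.univ n)
    (by intro k hk; rw [if_neg]; simpa using hk)]
  refine Finset.sum_bij (fun l _ => (l : Fin (M + 1) → ℕ)) ?_ ?_ ?_ ?_
  · intro l hl
    simpa using hl
  · intro a _ b _ hab
    exact DFunLike.coe_injective hab
  · intro k hk
    exact ⟨Finsupp.equivFunOnFinite.symm k, by simpa using hk, by simp⟩
  · intro l hl
    have hl' : ∑ j, l j = n := by simpa using hl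
    rw [if_pos hl', Finset.mul_sum, ← Finset.sum_add_distrib, Real.rpow_sum_of_pos hq.1,
      ← Finset.prod_div_distrib]
    refine Finset.prod_congr rfl fun j _ => ?_
    rw [← mul_div_assoc]
    congr 1
    rw [← Real.rpow_natCast q (M + 1), ← Real.rpow_mul hq.1.le, ← Real.rpow_natCast _ (l j),
      ← Real.rpow_mul hq.1.le, ← Real.rpow_add hq.1]
    congr 1
    ring
end
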